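/- arXiv:1810.02004 — 17 statements merged into one kernel-verified Lean document; each statement's English description precedes it below -/
import Mathlib

section
/- Let X be a connected topological space and R a continuous, non-trivial, semi-transitive binary relation on X whose symmetric part I is transitive. Then R is complete and transitive. -/
/-- Theorem 2 (k = 1), (a) ⇒ (e): on a connected topological space, every non-trivial,
semi-transitive, continuous binary relation whose symmetric part is transitive is
complete and transitive. -/
theorem connected_semiTrans_complete_trans
    {X : Type*} [TopologicalSpace X] [ConnectedSpace X] (R : Set (X × X))
    -- continuity: sections of R are closed, sections of the asymmetric part P are open
    (hRupper : ∀ x : X, IsClosed {y | (x, y) ∈ R})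
    (hRlower : ∀ x : X, IsClosed {y | (y, x) ∈ R})
    (hPupper : ∀ x : X, IsOpen {y | (x, y) ∈ R ∧ (y, x) ∉ R})
    (hPlower : ∀ x : X, IsOpen {y | (y, x) ∈ R ∧ (x, y) ∉ R})
    -- non-triviality
    (hNT : ∃ x y : X, (x, y) ∈ R ∧ (y, x) ∉ R)
    -- semi-transitivity: (PI) and (IP)
    (hPI : ∀ x y z : X, ((y, x) ∈ R ∧ (x, y) ∉ R) → ((x, z) ∈ R ∧ (z, x) ∈ R) →
      ((y, z) ∈ R ∧ (z, y) ∉ R))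
    (hIP : ∀ x y z : X, ((y, x) ∈ R ∧ (x, y) ∈ R) → ((x, z) ∈ R ∧ (z, x) ∉ R) →
      ((y, z) ∈ R ∧ (z, y) ∉ R))
    -- the symmetric part I is transitive
    (hItrans : ∀ x y z : X, ((x, y) ∈ R ∧ (y, x) ∈ R) → ((y, z) ∈ R ∧ (z, y) ∈ R) →
      ((x, z) ∈ R ∧ (z, x) ∈ R)) :
    (∀ x y : X, (x, y) ∈ R ∨ (y, x) ∈ R) ∧
    (∀ x y z : X, (x, y) ∈ R → (y, z) ∈ R → (x, z) ∈ R) := by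
  have neg_trans : ∀ x y z : X, ((x, y) ∈ R ∧ (y, x) ∉ R) →
      ((x, z) ∈ R ∧ (z, x) ∉ R) ∨ ((z, y) ∈ R ∧ (y, z) ∉ R) := by
    intro x y z hxy
    have hEq : {w | (x, w) ∈ R ∧ (w, x) ∉ R} ∪ {w | (w, y) ∈ R ∧ (y, w) ∉ R} =
        {w | (x, w) ∈ R} ∪ {w | (w, y) ∈ R} := by
      ext w
      have h₁ := hIP x w y
      have h₂ := hPI y x w
      simp only [Set.mem_union, Set.mem_ofPred_eq]
      tauto
    have hclopen : IsClopen
        ({w | (x, w) ∈ R ∧ (w, x) ∉ R} ∪ {w | (w, y) ∈ R ∧ (y, w) ∉ R}) :=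
      ⟨hEq ▸ (hRupper x).union (hRlower y), (hPupper x).union (hPlower y)⟩
    have huniv := hclopen.eq_univ ⟨y, Or.inl hxy⟩
    exact huniv.ge (Set.mem_univ z)
  have complete : ∀ x y : X, (x, y) ∈ R ∨ (y, x) ∈ R := by
    intro x y
    by_contra! hxy
    have upper_empty : ∀ z, ¬ ((x, z) ∈ R ∧ (z, x) ∉ R) := by
      intro z hz
      have hEq : {w | (x, w) ∈ R ∧ (w, x) ∉ R} = {w | (x, w) ∈ R} ∩ {w | (y, w) ∈ R} := by
        ext w
        have h₁ := neg_trans x w y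
        have h₂ := hPI w y x
        have h₃ := hItrans x w y
        simp only [Set.mem_inter_iff, Set.mem_ofPred_eq]
        tauto
      have hclopen : IsClopen {w | (x, w) ∈ R ∧ (w, x) ∉ R} :=
        ⟨hEq ▸ (hRupper x).inter (hRupper y), hPupper x⟩
      have hx : x ∈ {w | (x, w) ∈ R ∧ (w, x) ∉ R} :=
        hclopen.eq_univ ⟨z, hz⟩ ▸ Set.mem_univ x
      exact hx.2 hx.1
    have lower_empty : ∀ z, ¬ ((z, x) ∈ R ∧ (x, z) ∉ R) := by
      intro z hz
      have hEq : {w | (w, x) ∈ R ∧ (x, w) ∉ R} = {w | (w, x) ∈ R} ∩ {w | (w, y) ∈ R} := by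
        ext w
        have h₁ := neg_trans w x y
        have h₂ := hIP w x y
        have h₃ := hItrans x w y
        simp only [Set.mem_inter_iff, Set.mem_ofPred_eq]
        tauto
      have hclopen : IsClopen {w | (w, x) ∈ R ∧ (x, w) ∉ R} :=
        ⟨hEq ▸ (hRlower x).inter (hRlower y), hPlower x⟩
      have hx : x ∈ {w | (w, x) ∈ R ∧ (x, w) ∉ R} :=
        hclopen.eq_univ ⟨z, hz⟩ ▸ Set.mem_univ x
      exact hx.2 hx.1
    obtain ⟨a, b, hab⟩ := hNT
    exact (neg_trans a b x hab).elim (lower_empty a) (upper_empty b)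
  refine ⟨complete, fun x y z hxy hyz => ?_⟩
  by_contra hxz
  have hzx := (complete x z).resolve_left hxz
  exact (neg_trans z x y ⟨hzx, hxz⟩).elim (fun h => h.2 hyz) (fun h => h.2 hxy)
end

section
/- Let X be a connected topological space and R a continuous, non-trivial, anti-symmetric binary relation on X. Then R is complete and transitive. -/
/-- Theorem 2 (k = 1), (a) ⇒ (c): on a connected topological space, every non-trivial,
anti-symmetric, continuous binary relation is complete and transitive. -/
theorem connected_antisymm_complete_trans
    {X : Type*} [TopologicalSpace X] [ConnectedSpace X] (R : Set (X × X))
    -- continuity: sections of R are closed, sections of the asymmetric part P are open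
    (hRupper : ∀ x : X, IsClosed {y | (x, y) ∈ R})
    (hRlower : ∀ x : X, IsClosed {y | (y, x) ∈ R})
    (hPupper : ∀ x : X, IsOpen {y | (x, y) ∈ R ∧ (y, x) ∉ R})
    (hPlower : ∀ x : X, IsOpen {y | (y, x) ∈ R ∧ (x, y) ∉ R})
    -- non-triviality
    (hNT : ∃ x y : X, (x, y) ∈ R ∧ (y, x) ∉ R)
    -- anti-symmetry
    (hAS : ∀ x y : X, (x, y) ∈ R → (y, x) ∈ R → x = y) :
    (∀ x y : X, (x, y) ∈ R ∨ (y, x) ∈ R) ∧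
    (∀ x y z : X, (x, y) ∈ R → (y, z) ∈ R → (x, z) ∈ R) := by
  have hcut : ∀ x y : X, (x, y) ∈ R → (y, x) ∉ R →
      ∀ z, ((x, z) ∈ R ∧ (z, x) ∉ R) ∨ ((z, y) ∈ R ∧ (y, z) ∉ R) := by
    intro x y hxy hyx z
    have heq : {y' | (x, y') ∈ R ∧ (y', x) ∉ R} ∪ {x' | (x', y) ∈ R ∧ (y, x') ∉ R} =
        {y' | (x, y') ∈ R} ∪ {x' | (x', y) ∈ R} := by
      ext w
      simp only [Set.mem_union, Set.mem_ofPred_eq]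
      grind
    have hclopen : IsClopen
        ({y' | (x, y') ∈ R ∧ (y', x) ∉ R} ∪ {x' | (x', y) ∈ R ∧ (y, x') ∉ R}) :=
      ⟨heq ▸ (hRupper x).union (hRlower y), (hPupper x).union (hPlower y)⟩
    exact (hclopen.eq_univ ⟨y, Or.inl ⟨hxy, hyx⟩⟩).ge (Set.mem_univ z)
  obtain ⟨a, b, hab, hba⟩ := hNT
  have hupper_empty : ∀ z, ¬ IsClosed {y | (z, y) ∈ R ∧ (y, z) ∉ R} ∨
      ∀ y, (z, y) ∈ R → (y, z) ∈ R := by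
    intro z
    by_contra! ⟨hc, y, hzy⟩
    have h := (IsClopen.eq_univ ⟨hc, hPupper z⟩ ⟨y, hzy⟩).ge (Set.mem_univ z)
    exact h.2 h.1
  have hlower_empty : ∀ z, ¬ IsClosed {y | (y, z) ∈ R ∧ (z, y) ∉ R} ∨
      ∀ y, (y, z) ∈ R → (z, y) ∈ R := by
    intro z
    by_contra! ⟨hc, y, hzy⟩
    have h := (IsClopen.eq_univ ⟨hc, hPlower z⟩ ⟨y, hzy⟩).ge (Set.mem_univ z)
    exact h.2 h.1
  have hrefl : ∀ z, (z, z) ∈ R := by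
    intro z
    by_contra hz
    have hu : {y | (z, y) ∈ R ∧ (y, z) ∉ R} = {y | (z, y) ∈ R} := by
      ext w
      simp only [Set.mem_ofPred_eq]
      grind
    have hl : {y | (y, z) ∈ R ∧ (z, y) ∉ R} = {y | (y, z) ∈ R} := by
      ext w
      simp only [Set.mem_ofPred_eq]
      grind
    have hue := (hupper_empty z).resolve_left (not_not_intro (hu ▸ hRupper z))
    have hle := (hlower_empty z).resolve_left (not_not_intro (hl ▸ hRlower z))
    rcases hcut a b hab hba z with h | h
    · exact h.2 (hle a h.1)
    · exact h.2 (hue b h.1)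
  have hcomplete : ∀ z w : X, (z, w) ∈ R ∨ (w, z) ∈ R := by
    intro z w
    by_contra! ⟨hzw, hwz⟩
    have hu : {y | (z, y) ∈ R ∧ (y, z) ∉ R} = {y | (z, y) ∈ R} ∩ {y | (w, y) ∈ R} := by
      ext y
      simp only [Set.mem_inter_iff, Set.mem_ofPred_eq]
      grind
    have hl : {y | (y, z) ∈ R ∧ (z, y) ∉ R} = {y | (y, z) ∈ R} ∩ {y | (y, w) ∈ R} := by
      ext y
      simp only [Set.mem_inter_iff, Set.mem_ofPred_eq]
      grind
    have hue := (hupper_empty z).resolve_left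
      (not_not_intro (hu ▸ (hRupper z).inter (hRupper w)))
    have hle := (hlower_empty z).resolve_left
      (not_not_intro (hl ▸ (hRlower z).inter (hRlower w)))
    rcases hcut a b hab hba z with h | h
    · exact h.2 (hle a h.1)
    · exact h.2 (hue b h.1)
  refine ⟨hcomplete, fun x y z hxy hyz => ?_⟩
  by_cases hyx : (y, x) ∈ R
  · rwa [hAS x y hxy hyx]
  · rcases hcut x y hxy hyx z with h | h
    · exact h.1
    · exact absurd hyz h.2
end

section
/- Let X be a connected topological space and R a continuous, non-trivial binary relation on X whose symmetric part I is transitive and has connected sections (every set I(x) = {y : (x,y) ∈ I} is a connected subset of X). Then R is complete and transitive. -/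
/-- If `x` is strictly related to `y` by a continuous relation on a connected space whose symmetric
part is transitive and has connected sections, then every point is strictly below `x` or strictly
above `y`. -/
theorem strict_or_strict_of_strict {X : Type*} [TopologicalSpace X] [PreconnectedSpace X]
    {r : X → X → Prop}
    (hU : ∀ x, IsClosed {y | r x y}) (hL : ∀ x, IsClosed {y | r y x})
    (hPU : ∀ x, IsOpen {y | r x y ∧ ¬ r y x}) (hPL : ∀ x, IsOpen {y | r y x ∧ ¬ r x y})
    (hI : ∀ x y z, (r x y ∧ r y x) → (r y z ∧ r z y) → (r x z ∧ r z x))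
    (hconn : ∀ x, IsPreconnected {y | r x y ∧ r y x})
    {x y : X} (hxy : r x y ∧ ¬ r y x) (z : X) : (r x z ∧ ¬ r z x) ∨ (r z y ∧ ¬ r y z) := by
  have left : ∀ z, (r x z ∧ r z x) → (r z y ∧ ¬ r y z) := by
    intro z hz
    refine (hconn x).subset_of_closure_inter_subset (hPL y)
      ⟨x, hI x z x hz hz.symm, hxy⟩ ?_ hz
    rintro q ⟨hq, hxq⟩
    have hqy : r q y := closure_minimal (fun _ h => h.1) (hL y) hq
    exact ⟨hqy, fun h => hxy.2 (hI x q y hxq ⟨hqy, h⟩).2⟩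
  have right : ∀ z, (r y z ∧ r z y) → (r x z ∧ ¬ r z x) := by
    intro z hz
    refine (hconn y).subset_of_closure_inter_subset (hPU x)
      ⟨y, hI y z y hz hz.symm, hxy⟩ ?_ hz
    rintro q ⟨hq, hyq⟩
    have hxq : r x q := closure_minimal (fun _ h => h.1) (hU x) hq
    exact ⟨hxq, fun h => hxy.2 (hI y q x hyq ⟨h, hxq⟩).1⟩
  have heq : {z | r x z ∧ ¬ r z x} ∪ {z | r z y ∧ ¬ r y z} = {z | r x z} ∪ {z | r z y} := by
    ext z
    have hl := left z
    have hr := right z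
    simp only [Set.mem_union, Set.mem_ofPred_eq]
    tauto
  have hclopen : IsClopen ({z | r x z ∧ ¬ r z x} ∪ {z | r z y ∧ ¬ r y z}) :=
    ⟨heq ▸ (hU x).union (hL y), (hPU x).union (hPL y)⟩
  exact Set.eq_univ_iff_forall.mp (hclopen.eq_univ ⟨y, Or.inl hxy⟩) z

/-- A point with a nonempty strict upper section is comparable to every point. -/
theorem comparable_of_strict {X : Type*} [TopologicalSpace X] [PreconnectedSpace X]
    {r : X → X → Prop}
    (hU : ∀ x, IsClosed {y | r x y}) (hPU : ∀ x, IsOpen {y | r x y ∧ ¬ r y x})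
    (hI : ∀ x y z, (r x y ∧ r y x) → (r y z ∧ r z y) → (r x z ∧ r z x))
    (hneg : ∀ x y, (r x y ∧ ¬ r y x) → ∀ z, (r x z ∧ ¬ r z x) ∨ (r z y ∧ ¬ r y z))
    {z u : X} (hzu : r z u ∧ ¬ r u z) (w : X) : r z w ∨ r w z := by
  by_contra hzw
  have heq : {q | r z q ∧ ¬ r q z} = {q | r z q} ∩ {q | r w q} := by
    ext q
    have h₁ := fun h => hneg z q h w
    have h₂ := fun h => hneg w q h z
    have h₃ := hI z q w
    simp only [Set.mem_inter_iff, Set.mem_ofPred_eq]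
    tauto
  have hclopen : IsClopen {q | r z q ∧ ¬ r q z} := ⟨heq ▸ (hU z).inter (hU w), hPU z⟩
  have hz : r z z ∧ ¬ r z z := Set.eq_univ_iff_forall.mp (hclopen.eq_univ ⟨u, hzu⟩) z
  exact hz.2 hz.1


/-- Theorem 2 (k = 1), (a) ⇒ (d): on a connected topological space, every non-trivial,
continuous binary relation whose symmetric part I is transitive and has connected
sections is complete and transitive.  (Connectedness of a possibly empty subset is
`IsPreconnected`, matching the paper's definition of a connected set.) -/
theorem connected_symConnSections_complete_trans
    {X : Type*} [TopologicalSpace X] [ConnectedSpace X] (R : Set (X × X))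
    -- continuity: sections of R are closed, sections of the asymmetric part P are open
    (hRupper : ∀ x : X, IsClosed {y | (x, y) ∈ R})
    (hRlower : ∀ x : X, IsClosed {y | (y, x) ∈ R})
    (hPupper : ∀ x : X, IsOpen {y | (x, y) ∈ R ∧ (y, x) ∉ R})
    (hPlower : ∀ x : X, IsOpen {y | (y, x) ∈ R ∧ (x, y) ∉ R})
    -- non-triviality
    (hNT : ∃ x y : X, (x, y) ∈ R ∧ (y, x) ∉ R)
    -- the symmetric part I is transitive
    (hItrans : ∀ x y z : X, ((x, y) ∈ R ∧ (y, x) ∈ R) → ((y, z) ∈ R ∧ (z, y) ∈ R) →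
      ((x, z) ∈ R ∧ (z, x) ∈ R))
    -- the sections of the symmetric part I are connected
    (hIconn : ∀ x : X, IsPreconnected {y | (x, y) ∈ R ∧ (y, x) ∈ R}) :
    (∀ x y : X, (x, y) ∈ R ∨ (y, x) ∈ R) ∧
    (∀ x y z : X, (x, y) ∈ R → (y, z) ∈ R → (x, z) ∈ R) := by
  have hneg : ∀ x y, ((x, y) ∈ R ∧ (y, x) ∉ R) →
      ∀ z, ((x, z) ∈ R ∧ (z, x) ∉ R) ∨ ((z, y) ∈ R ∧ (y, z) ∉ R) := fun _ _ h =>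
    strict_or_strict_of_strict (r := fun a b => (a, b) ∈ R)
      hRupper hRlower hPupper hPlower hItrans hIconn h
  have hcomplete : ∀ x y, (x, y) ∈ R ∨ (y, x) ∈ R := by
    intro x y
    obtain ⟨a, b, hab⟩ := hNT
    rcases hneg a b hab x with h | h
    · exact (comparable_of_strict (r := fun a b => (b, a) ∈ R) hRlower hPlower
        (fun p q s h₁ h₂ => (hItrans p q s h₁.symm h₂.symm).symm)
        (fun p q h s => (hneg q p h s).symm) h y).symm
    · exact comparable_of_strict (r := fun a b => (a, b) ∈ R) hRupper hPupper hItrans hneg h y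
  refine ⟨hcomplete, fun x y z hxy hyz => ?_⟩
  by_contra hxz
  rcases hneg z x ⟨(hcomplete x z).resolve_left hxz, hxz⟩ y with h | h
  · exact h.2 hyz
  · exact h.2 hxy
end

section
/- (Schmeidler) Let X be a connected topological space and R a continuous, non-trivial, transitive binary relation on X. Then R is complete. -/
/-- Schmeidler's theorem: on a connected topological space, every non-trivial,
transitive and continuous binary relation is complete. -/
theorem schmeidler_complete
    {X : Type*} [TopologicalSpace X] [ConnectedSpace X] (R : Set (X × X))
    -- continuity: sections of R are closed, sections of the asymmetric part P are open
    (hRupper : ∀ x : X, IsClosed {y | (x, y) ∈ R})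
    (hRlower : ∀ x : X, IsClosed {y | (y, x) ∈ R})
    (hPupper : ∀ x : X, IsOpen {y | (x, y) ∈ R ∧ (y, x) ∉ R})
    (hPlower : ∀ x : X, IsOpen {y | (y, x) ∈ R ∧ (x, y) ∉ R})
    -- non-triviality
    (hNT : ∃ x y : X, (x, y) ∈ R ∧ (y, x) ∉ R)
    -- transitivity
    (hTrans : ∀ x y z : X, (x, y) ∈ R → (y, z) ∈ R → (x, z) ∈ R) :
    ∀ x y : X, (x, y) ∈ R ∨ (y, x) ∈ R := by
  have key : ∀ a b : X, (a, b) ∈ R → (b, a) ∉ R → ∀ z : X,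
      ((a, z) ∈ R ∧ (z, a) ∉ R) ∨ ((z, b) ∈ R ∧ (b, z) ∉ R) := by
    intro a b hab hba
    have heq : {z | (a, z) ∈ R ∧ (z, a) ∉ R} ∪ {z | (z, b) ∈ R ∧ (b, z) ∉ R} =
        {z | (a, z) ∈ R} ∪ {z | (z, b) ∈ R} := by
      ext z
      simp only [Set.mem_union, Set.mem_ofPred_eq]
      have h₁ := hTrans z a b
      have h₂ := hTrans b z a
      have h₃ := hTrans a z b
      have h₄ := hTrans a b z
      tauto
    have hclopen : IsClopen ({z | (a, z) ∈ R ∧ (z, a) ∉ R} ∪ {z | (z, b) ∈ R ∧ (b, z) ∉ R}) :=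
      ⟨heq ▸ (hRupper a).union (hRlower b), (hPupper a).union (hPlower b)⟩
    have huniv := hclopen.eq_univ ⟨b, Or.inl ⟨hab, hba⟩⟩
    exact fun z => Set.eq_univ_iff_forall.mp huniv z
  intro x y
  by_contra! hxy
  obtain ⟨hnxy, hnyx⟩ := hxy
  obtain ⟨a, b, hab, hba⟩ := hNT
  rcases key a b hab hba x with hx | hx
  · have hy : (a, y) ∈ R ∧ (y, a) ∉ R := by
      rcases key a x hx.1 hx.2 y with h | h
      · exact h
      · exact absurd h.1 hnyx
    have heq : {z | (z, x) ∈ R ∧ (x, z) ∉ R} ∩ {z | (z, y) ∈ R ∧ (y, z) ∉ R} =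
        {z | (z, x) ∈ R} ∩ {z | (z, y) ∈ R} := by
      ext z
      simp only [Set.mem_inter_iff, Set.mem_ofPred_eq]
      have h₁ := hTrans x z y
      have h₂ := hTrans y z x
      tauto
    have hclopen : IsClopen
        ({z | (z, x) ∈ R ∧ (x, z) ∉ R} ∩ {z | (z, y) ∈ R ∧ (y, z) ∉ R}) :=
      ⟨heq ▸ (hRlower x).inter (hRlower y), (hPlower x).inter (hPlower y)⟩
    have huniv := hclopen.eq_univ ⟨a, hx, hy⟩
    exact hnxy (Set.eq_univ_iff_forall.mp huniv x).2.1
  · have hy : (y, b) ∈ R ∧ (b, y) ∉ R := by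
      rcases key x b hx.1 hx.2 y with h | h
      · exact absurd h.1 hnxy
      · exact h
    have heq : {z | (x, z) ∈ R ∧ (z, x) ∉ R} ∩ {z | (y, z) ∈ R ∧ (z, y) ∉ R} =
        {z | (x, z) ∈ R} ∩ {z | (y, z) ∈ R} := by
      ext z
      simp only [Set.mem_inter_iff, Set.mem_ofPred_eq]
      have h₁ := hTrans x z y
      have h₂ := hTrans y z x
      tauto
    have hclopen : IsClopen
        ({z | (x, z) ∈ R ∧ (z, x) ∉ R} ∩ {z | (y, z) ∈ R ∧ (z, y) ∉ R}) :=
      ⟨heq ▸ (hRupper x).inter (hRupper y), (hPupper x).inter (hPupper y)⟩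
    have huniv := hclopen.eq_univ ⟨b, hx, hy⟩
    exact hnyx (Set.eq_univ_iff_forall.mp huniv x).2.1
end

section
/- Let X be any topological space and R a componentwise non-trivial, semi-transitive and continuous binary relation on X whose symmetric part I is transitive. Then R is complete. -/
/-- If an open set equals a closed set, it contains the component of each of its points. -/
theorem mem_isOpen_of_mem_connectedComponent {X : Type*} [TopologicalSpace X]
    {U F : Set X} (hU : IsOpen U) (hF : IsClosed F) (hUF : U ⊆ F) (hFU : F ⊆ U)
    {x y : X} (hx : x ∈ F) (hy : y ∈ connectedComponent x) : y ∈ U := by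
  obtain rfl : U = F := hUF.antisymm hFU
  exact IsClopen.connectedComponent_subset ⟨hF, hU⟩ hx hy

/-- Proposition 2 (first part): on any topological space, every componentwise
non-trivial, semi-transitive and continuous binary relation whose symmetric part is
transitive is complete. -/
theorem componentwiseNontrivial_complete
    {X : Type*} [TopologicalSpace X] (R : Set (X × X))
    -- componentwise non-triviality:
    -- (i) within each connected component there is a strictly comparable pair
    (hcw1 : ∀ x : X, ∃ a ∈ connectedComponent x, ∃ b ∈ connectedComponent x,
      (a, b) ∈ R ∧ (b, a) ∉ R)
    -- (ii) across any two distinct components there is a weakly comparable pair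
    (hcw2 : ∀ x y : X, connectedComponent x ≠ connectedComponent y →
      ∃ a ∈ connectedComponent x, ∃ b ∈ connectedComponent y,
        (a, b) ∈ R ∨ (b, a) ∈ R)
    -- continuity: sections of R are closed, sections of the asymmetric part P are open
    (hRupper : ∀ x : X, IsClosed {y | (x, y) ∈ R})
    (hRlower : ∀ x : X, IsClosed {y | (y, x) ∈ R})
    (hPupper : ∀ x : X, IsOpen {y | (x, y) ∈ R ∧ (y, x) ∉ R})
    (hPlower : ∀ x : X, IsOpen {y | (y, x) ∈ R ∧ (x, y) ∉ R})
    -- semi-transitivity: (PI) and (IP)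
    (hPI : ∀ x y z : X, ((y, x) ∈ R ∧ (x, y) ∉ R) → ((x, z) ∈ R ∧ (z, x) ∈ R) →
      ((y, z) ∈ R ∧ (z, y) ∉ R))
    (hIP : ∀ x y z : X, ((y, x) ∈ R ∧ (x, y) ∈ R) → ((x, z) ∈ R ∧ (z, x) ∉ R) →
      ((y, z) ∈ R ∧ (z, y) ∉ R))
    -- the symmetric part I is transitive
    (hItrans : ∀ x y z : X, ((x, y) ∈ R ∧ (y, x) ∈ R) → ((y, z) ∈ R ∧ (z, y) ∈ R) →
      ((x, z) ∈ R ∧ (z, x) ∈ R)) :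
    ∀ x y : X, (x, y) ∈ R ∨ (y, x) ∈ R := by
  -- A strict pair splits the components of both of its members.
  have strict_split : ∀ x y w z : X, (x, y) ∈ R → (y, x) ∉ R → (w = x ∨ w = y) →
      z ∈ connectedComponent w →
      ((z, y) ∈ R ∧ (y, z) ∉ R) ∨ ((x, z) ∈ R ∧ (z, x) ∉ R) := by
    intro x y w z hxy hyx hw hz
    refine mem_isOpen_of_mem_connectedComponent ((hPlower y).union (hPupper x))
      ((hRlower y).union (hRupper x)) ?_ ?_ ?_ hz
    · rintro t (h | h)
      exacts [Or.inl h.1, Or.inr h.1]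
    · rintro t (h | h)
      · by_cases h' : (y, t) ∈ R
        · exact Or.inr (hPI y x t ⟨hxy, hyx⟩ ⟨h', h⟩)
        · exact Or.inl ⟨h, h'⟩
      · by_cases h' : (t, x) ∈ R
        · exact Or.inl (hIP x t y ⟨h', h⟩ ⟨hxy, hyx⟩)
        · exact Or.inr ⟨h, h'⟩
    · rcases hw with rfl | rfl
      exacts [Or.inl hxy, Or.inr hxy]
  -- No point in the component of `z` is comparable to both members of an incomparable pair.
  have no_common : ∀ z w t : X, (z, w) ∉ R → (w, z) ∉ R → z ∈ connectedComponent t →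
      ((z, t) ∈ R ∨ (t, z) ∈ R) → ((w, t) ∈ R ∨ (t, w) ∈ R) → False := by
    intro z w t hzw hwz hz h₁ h₂
    rcases h₁ with h₁ | h₁ <;> rcases h₂ with h₂ | h₂
    · have key := mem_isOpen_of_mem_connectedComponent
        ((hPupper z).inter (hPupper w)) ((hRupper z).inter (hRupper w))
        (fun s h => ⟨h.1.1, h.2.1⟩) ?_ ⟨h₁, h₂⟩ hz
      · exact key.1.2 key.1.1
      · rintro s ⟨a, b⟩
        simp only [Set.mem_inter_iff, Set.mem_ofPred_eq] at a b ⊢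
        grind
    · have key := mem_isOpen_of_mem_connectedComponent
        ((hPupper z).inter (hPlower w)) ((hRupper z).inter (hRlower w))
        (fun s h => ⟨h.1.1, h.2.1⟩) ?_ ⟨h₁, h₂⟩ hz
      · exact key.1.2 key.1.1
      · rintro s ⟨a, b⟩
        simp only [Set.mem_inter_iff, Set.mem_ofPred_eq] at a b ⊢
        grind
    · have key := mem_isOpen_of_mem_connectedComponent
        ((hPlower z).inter (hPupper w)) ((hRlower z).inter (hRupper w))
        (fun s h => ⟨h.1.1, h.2.1⟩) ?_ ⟨h₁, h₂⟩ hz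
      · exact key.1.2 key.1.1
      · rintro s ⟨a, b⟩
        simp only [Set.mem_inter_iff, Set.mem_ofPred_eq] at a b ⊢
        grind
    · have key := mem_isOpen_of_mem_connectedComponent
        ((hPlower z).inter (hPlower w)) ((hRlower z).inter (hRlower w))
        (fun s h => ⟨h.1.1, h.2.1⟩) ?_ ⟨h₁, h₂⟩ hz
      · exact key.1.2 key.1.1
      · rintro s ⟨a, b⟩
        simp only [Set.mem_inter_iff, Set.mem_ofPred_eq] at a b ⊢
        grind
  have complete_on_component : ∀ z w : X, w ∈ connectedComponent z →
      (z, w) ∈ R ∨ (w, z) ∈ R := by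
    intro z w hw
    by_contra! h
    obtain ⟨x, hx, y, hy, hxy, hyx⟩ := hcw1 z
    have ex := connectedComponent_eq hx
    have ey := connectedComponent_eq hy
    rcases strict_split x y x z hxy hyx (Or.inl rfl) (ex ▸ mem_connectedComponent) with hz | hz
    · rcases strict_split z y z w hz.1 hz.2 (Or.inl rfl) hw with h' | h'
      · exact no_common z w y h.1 h.2 (ey ▸ mem_connectedComponent) (Or.inl hz.1) (Or.inl h'.1)
      · exact h.1 h'.1
    · rcases strict_split x z z w hz.1 hz.2 (Or.inr rfl) hw with h' | h'
      · exact h.2 h'.1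
      · exact no_common z w x h.1 h.2 (ex ▸ mem_connectedComponent) (Or.inr hz.1) (Or.inr h'.1)
  have incomparable_component : ∀ z w t : X, (z, w) ∉ R → (w, z) ∉ R →
      t ∈ connectedComponent z → (t, w) ∉ R ∧ (w, t) ∉ R := by
    intro z w t hzw hwz ht
    have no_comparison := no_common z w t hzw hwz
      (connectedComponent_eq ht ▸ mem_connectedComponent) (complete_on_component z t ht)
    exact ⟨fun h => no_comparison (Or.inr h), fun h => no_comparison (Or.inl h)⟩
  intro x y
  by_contra! h
  by_cases hc : connectedComponent x = connectedComponent y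
  · have hy : y ∈ connectedComponent x := hc ▸ mem_connectedComponent
    exact (complete_on_component x y hy).elim h.1 h.2
  · obtain ⟨a, ha, b, hb, hab⟩ := hcw2 x y hc
    have hay := incomparable_component x y a h.1 h.2 ha
    have hba := incomparable_component y a b hay.2 hay.1 hb
    exact hab.elim hba.2 hba.1
end

section
/- Let X be a topological space with at most two connected components and R a componentwise non-trivial, semi-transitive and continuous binary relation on X whose symmetric part I is transitive. Then R is complete and transitive. -/
/-- The asymmetric part of a binary relation. -/
def StrictPart {X : Type*} (R : Set (X × X)) (x y : X) : Prop := (x, y) ∈ R ∧ (y, x) ∉ R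

/-- The symmetric part of a binary relation. -/
def SymmPart {X : Type*} (R : Set (X × X)) (x y : X) : Prop := (x, y) ∈ R ∧ (y, x) ∈ R

/-- Continuous semi-transitive binary relations with transitive symmetric part. -/
structure IsContSemiTrans {X : Type*} [TopologicalSpace X] (R : Set (X × X)) : Prop where
  closed_upper : ∀ x : X, IsClosed {y | (x, y) ∈ R}
  closed_lower : ∀ x : X, IsClosed {y | (y, x) ∈ R}
  open_upper : ∀ x : X, IsOpen {y | StrictPart R x y}
  open_lower : ∀ x : X, IsOpen {y | StrictPart R y x}
  strict_symm : ∀ {x y z : X}, StrictPart R y x → SymmPart R x z → StrictPart R y z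
  symm_strict : ∀ {x y z : X}, SymmPart R y x → StrictPart R x z → StrictPart R y z
  symm_trans : ∀ {x y z : X}, SymmPart R x y → SymmPart R y z → SymmPart R x z

namespace IsContSemiTrans

variable {X : Type*} [TopologicalSpace X] {R : Set (X × X)}

theorem swap (h : IsContSemiTrans R) : IsContSemiTrans (Prod.swap ⁻¹' R) where
  closed_upper := h.closed_lower
  closed_lower := h.closed_upper
  open_upper := h.open_lower
  open_lower := h.open_upper
  strict_symm hyx hxz := h.symm_strict ⟨hxz.1, hxz.2⟩ hyx
  symm_strict hyx hxz := h.strict_symm hxz ⟨hyx.1, hyx.2⟩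
  symm_trans hxy hyz := h.symm_trans ⟨hxy.2, hxy.1⟩ ⟨hyz.2, hyz.1⟩ |>.symm

/-- Negative transitivity of the asymmetric part along components. -/
theorem strict_or_strict (h : IsContSemiTrans R) {x y z : X} (hxy : StrictPart R x y)
    (hz : z ∈ connectedComponent x ∨ z ∈ connectedComponent y) :
    StrictPart R z y ∨ StrictPart R x z := by
  have heq : {z | StrictPart R z y} ∪ {z | StrictPart R x z} =
      {z | (z, y) ∈ R} ∪ {z | (x, z) ∈ R} := by
    ext u
    refine ⟨Or.imp And.left And.left, ?_⟩
    rintro (hu | hu)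
    · by_cases hyu : (y, u) ∈ R
      · exact Or.inr (h.strict_symm hxy ⟨hyu, hu⟩)
      · exact Or.inl ⟨hu, hyu⟩
    · by_cases hux : (u, x) ∈ R
      · exact Or.inl (h.symm_strict ⟨hux, hu⟩ hxy)
      · exact Or.inr ⟨hu, hux⟩
  have hclopen : IsClopen ({z | StrictPart R z y} ∪ {z | StrictPart R x z}) :=
    ⟨heq ▸ (h.closed_lower y).union (h.closed_upper x),
      (h.open_lower y).union (h.open_upper x)⟩
  rcases hz with hz | hz
  · exact hclopen.connectedComponent_subset (Or.inl hxy) hz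
  · exact hclopen.connectedComponent_subset (Or.inr hxy) hz

/-- A common strict lower bound of two incomparable points lies outside their components. -/
theorem notMem_of_strict_lower (h : IsContSemiTrans R) {v w y : X} (hvw : (v, w) ∉ R)
    (hwv : (w, v) ∉ R) (hv : StrictPart R v y) (hw : StrictPart R w y) :
    v ∉ connectedComponent y := by
  have heq : {u | StrictPart R v u} ∩ {u | StrictPart R w u} =
      {u | (v, u) ∈ R} ∩ {u | (w, u) ∈ R} := by
    ext u
    refine ⟨And.imp And.left And.left, ?_⟩
    rintro ⟨hvu, hwu⟩
    by_cases huv : (u, v) ∈ R <;> by_cases huw : (u, w) ∈ R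
    · exact absurd (h.symm_trans ⟨hvu, huv⟩ ⟨huw, hwu⟩).1 hvw
    · exact absurd (h.strict_symm ⟨hwu, huw⟩ ⟨huv, hvu⟩).1 hwv
    · exact absurd (h.strict_symm ⟨hvu, huv⟩ ⟨huw, hwu⟩).1 hvw
    · exact ⟨⟨hvu, huv⟩, hwu, huw⟩
  have hclopen : IsClopen ({u | StrictPart R v u} ∩ {u | StrictPart R w u}) :=
    ⟨heq ▸ (h.closed_upper v).inter (h.closed_upper w),
      (h.open_upper v).inter (h.open_upper w)⟩
  intro hmem
  have hvv := (hclopen.connectedComponent_subset ⟨hv, hw⟩ hmem).1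
  exact hvv.2 hvv.1

/-- A common strict upper bound of two incomparable points lies outside their components. -/
theorem notMem_of_strict_upper (h : IsContSemiTrans R) {v w y : X} (hvw : (v, w) ∉ R)
    (hwv : (w, v) ∉ R) (hv : StrictPart R y v) (hw : StrictPart R y w) :
    v ∉ connectedComponent y :=
  h.swap.notMem_of_strict_lower hwv hvw hv hw

theorem total_of_mem_component (h : IsContSemiTrans R) {v w y : X}
    (hv : v ∈ connectedComponent y) (hw : w ∈ connectedComponent y)
    (hy : StrictPart R v y ∨ StrictPart R y v) : (v, w) ∈ R ∨ (w, v) ∈ R := by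
  by_contra! hvw
  rcases hy with hy | hy
  · rcases h.strict_or_strict hy (Or.inr hw) with hwy | hvw'
    · exact h.notMem_of_strict_lower hvw.1 hvw.2 hy hwy hv
    · exact hvw.1 hvw'.1
  · rcases h.strict_or_strict hy (Or.inl hw) with hwv | hyw
    · exact hvw.2 hwv.1
    · exact h.notMem_of_strict_upper hvw.1 hvw.2 hy hyw hv

theorem total_of_strict_across (h : IsContSemiTrans R) {a b v w : X} (hab : StrictPart R a b)
    (hv : v ∈ connectedComponent a) (hw : w ∈ connectedComponent b) :
    (v, w) ∈ R ∨ (w, v) ∈ R := by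
  by_contra! hvw
  have hvb : ¬ StrictPart R v b := fun hvb =>
    (h.strict_or_strict hvb (Or.inr hw)).elim
      (fun hwb => h.notMem_of_strict_lower hvw.2 hvw.1 hwb hvb hw) fun h' => hvw.1 h'.1
  have hav : StrictPart R a v := (h.strict_or_strict hab (Or.inl hv)).resolve_left hvb
  have haw : ¬ StrictPart R a w := fun haw =>
    h.notMem_of_strict_upper hvw.1 hvw.2 hav haw hv
  have hwb : StrictPart R w b := (h.strict_or_strict hab (Or.inr hw)).resolve_right haw
  have hbv : (b, v) ∉ R := by
    intro hbv
    by_cases hvb' : (v, b) ∈ R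
    · exact hvw.2 (h.strict_symm hwb ⟨hbv, hvb'⟩).1
    · rcases h.strict_or_strict ⟨hbv, hvb'⟩ (Or.inl hw) with hwv | hbw
      · exact hvw.2 hwv.1
      · exact hwb.2 hbw.1
  exact h.notMem_of_strict_upper (fun h' => hvb ⟨h', hbv⟩) hbv hav hab hv

/-- The asymmetric part has no 3-cycle whose last point shares a component with another one. -/
theorem not_cycle_of_mem_component (h : IsContSemiTrans R) {x y z : X} (hxy : StrictPart R x y)
    (hyz : StrictPart R y z) (hzx : StrictPart R z x)
    (hz : z ∈ connectedComponent x ∨ z ∈ connectedComponent y) : False :=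
  (h.strict_or_strict hxy hz).elim (fun hzy => hyz.2 hzy.1) fun hxz => hzx.2 hxz.1

end IsContSemiTrans

/-- Proposition 2 (second part): on a topological space with at most two connected
components, every componentwise non-trivial, semi-transitive and continuous binary
relation whose symmetric part is transitive is complete and transitive. -/
theorem componentwiseNontrivial_twoComponents_complete_trans
    {X : Type*} [TopologicalSpace X] (R : Set (X × X))
    -- X has at most two connected components
    (htwo : ∀ x y z : X, connectedComponent x = connectedComponent y ∨
      connectedComponent x = connectedComponent z ∨
      connectedComponent y = connectedComponent z)
    -- componentwise non-triviality
    (hcw1 : ∀ x : X, ∃ a ∈ connectedComponent x, ∃ b ∈ connectedComponent x,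
      (a, b) ∈ R ∧ (b, a) ∉ R)
    (hcw2 : ∀ x y : X, connectedComponent x ≠ connectedComponent y →
      ∃ a ∈ connectedComponent x, ∃ b ∈ connectedComponent y,
        (a, b) ∈ R ∨ (b, a) ∈ R)
    -- continuity: sections of R are closed, sections of the asymmetric part P are open
    (hRupper : ∀ x : X, IsClosed {y | (x, y) ∈ R})
    (hRlower : ∀ x : X, IsClosed {y | (y, x) ∈ R})
    (hPupper : ∀ x : X, IsOpen {y | (x, y) ∈ R ∧ (y, x) ∉ R})
    (hPlower : ∀ x : X, IsOpen {y | (y, x) ∈ R ∧ (x, y) ∉ R})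
    -- semi-transitivity: (PI) and (IP)
    (hPI : ∀ x y z : X, ((y, x) ∈ R ∧ (x, y) ∉ R) → ((x, z) ∈ R ∧ (z, x) ∈ R) →
      ((y, z) ∈ R ∧ (z, y) ∉ R))
    (hIP : ∀ x y z : X, ((y, x) ∈ R ∧ (x, y) ∈ R) → ((x, z) ∈ R ∧ (z, x) ∉ R) →
      ((y, z) ∈ R ∧ (z, y) ∉ R))
    -- the symmetric part I is transitive
    (hItrans : ∀ x y z : X, ((x, y) ∈ R ∧ (y, x) ∈ R) → ((y, z) ∈ R ∧ (z, y) ∈ R) →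
      ((x, z) ∈ R ∧ (z, x) ∈ R)) :
    (∀ x y : X, (x, y) ∈ R ∨ (y, x) ∈ R) ∧
    (∀ x y z : X, (x, y) ∈ R → (y, z) ∈ R → (x, z) ∈ R) := by
  have h : IsContSemiTrans R := ⟨hRupper, hRlower, hPupper, hPlower, fun {x y z} => hPI x y z,
    fun {x y z} => hIP x y z, fun {x y z} => hItrans x y z⟩
  have hmem : ∀ {x y : X}, connectedComponent x = connectedComponent y →
      y ∈ connectedComponent x := fun e => e ▸ mem_connectedComponent
  have hstrict : ∀ v : X, ∃ y, connectedComponent y = connectedComponent v ∧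
      (StrictPart R v y ∨ StrictPart R y v) := by
    intro v
    obtain ⟨a, ha, b, hb, hab⟩ := hcw1 v
    have hva : v ∈ connectedComponent a := hmem (connectedComponent_eq ha).symm
    rcases h.strict_or_strict hab (Or.inl hva) with h' | h'
    · exact ⟨b, (connectedComponent_eq hb).symm, Or.inl h'⟩
    · exact ⟨a, (connectedComponent_eq ha).symm, Or.inr h'⟩
  have htotal : ∀ x y : X, (x, y) ∈ R ∨ (y, x) ∈ R := by
    intro v w
    by_cases hvw : connectedComponent v = connectedComponent w
    · obtain ⟨y, hy, hvy⟩ := hstrict v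
      exact h.total_of_mem_component (hmem hy) (hmem (hy.trans hvw)) hvy
    obtain ⟨a, ha, b, hb, hab⟩ := hcw2 v w hvw
    have hav := (connectedComponent_eq ha).symm
    have hbw := (connectedComponent_eq hb).symm
    have key : ∀ {a b : X}, connectedComponent a = connectedComponent v →
        connectedComponent b = connectedComponent w → StrictPart R a b ∨ StrictPart R b a →
        (v, w) ∈ R ∨ (w, v) ∈ R := by
      rintro a b ha hb (hab | hba)
      · exact h.total_of_strict_across hab (hmem ha) (hmem hb)
      · exact (h.total_of_strict_across hba (hmem hb) (hmem ha)).symm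
    by_cases h1 : (a, b) ∈ R <;> by_cases h2 : (b, a) ∈ R
    · obtain ⟨c, hc, hac | hca⟩ := hstrict a
      · exact key (hc.trans hav) hbw (Or.inr (h.symm_strict ⟨h2, h1⟩ hac))
      · exact key (hc.trans hav) hbw (Or.inl (h.strict_symm hca ⟨h1, h2⟩))
    · exact key hav hbw (Or.inl ⟨h1, h2⟩)
    · exact key hav hbw (Or.inr ⟨h2, h1⟩)
    · exact (hab.elim h1 h2).elim
  refine ⟨htotal, fun x y z hxy hyz => ?_⟩
  by_cases hyx : (y, x) ∈ R <;> by_cases hzy : (z, y) ∈ R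
  · exact (h.symm_trans ⟨hxy, hyx⟩ ⟨hyz, hzy⟩).1
  · exact (h.symm_strict ⟨hxy, hyx⟩ ⟨hyz, hzy⟩).1
  · exact (h.strict_symm ⟨hxy, hyx⟩ ⟨hyz, hzy⟩).1
  · by_contra hxz
    have hzx : StrictPart R z x := ⟨(htotal x z).resolve_left hxz, hxz⟩
    rcases htwo x y z with e | e | e
    · exact h.not_cycle_of_mem_component ⟨hyz, hzy⟩ hzx ⟨hxy, hyx⟩ (Or.inl (hmem e.symm))
    · exact h.not_cycle_of_mem_component ⟨hxy, hyx⟩ ⟨hyz, hzy⟩ hzx (Or.inl (hmem e))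
    · exact h.not_cycle_of_mem_component ⟨hxy, hyx⟩ ⟨hyz, hzy⟩ hzx (Or.inr (hmem e))
end

section
/- Let X be a topological space and R a semi-transitive and continuous binary relation on X. Let C and C' be connected components of X (possibly equal) and suppose x ∈ C, y ∈ C' satisfy (x,y) ∈ P, where P is the asymmetric part of R. Then C ∪ C' ⊆ P(x) ∪ P⁻¹(y), i.e. every z ∈ C ∪ C' satisfies (x,z) ∈ P or (z,y) ∈ P. -/
/-- Lemma 1: let R be a semi-transitive and continuous binary relation on a topological
space X, let C and C' be connected components of X (possibly equal) and let x ∈ C,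
y ∈ C' with (x,y) in the asymmetric part P of R.  Then C ∪ C' ⊆ P(x) ∪ P⁻¹(y). -/
theorem component_cover_lemma
    {X : Type*} [TopologicalSpace X] (R : Set (X × X))
    -- continuity: sections of R are closed, sections of the asymmetric part P are open
    (hRupper : ∀ x : X, IsClosed {y | (x, y) ∈ R})
    (hRlower : ∀ x : X, IsClosed {y | (y, x) ∈ R})
    (hPupper : ∀ x : X, IsOpen {y | (x, y) ∈ R ∧ (y, x) ∉ R})
    (hPlower : ∀ x : X, IsOpen {y | (y, x) ∈ R ∧ (x, y) ∉ R})
    -- semi-transitivity: (PI) and (IP)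
    (hPI : ∀ x y z : X, ((y, x) ∈ R ∧ (x, y) ∉ R) → ((x, z) ∈ R ∧ (z, x) ∈ R) →
      ((y, z) ∈ R ∧ (z, y) ∉ R))
    (hIP : ∀ x y z : X, ((y, x) ∈ R ∧ (x, y) ∈ R) → ((x, z) ∈ R ∧ (z, x) ∉ R) →
      ((y, z) ∈ R ∧ (z, y) ∉ R))
    -- C and C' are connected components of X
    (C C' : Set X)
    (hC : ∃ a : X, C = connectedComponent a)
    (hC' : ∃ b : X, C' = connectedComponent b)
    (x y : X) (hx : x ∈ C) (hy : y ∈ C')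
    -- (x, y) belongs to the asymmetric part P
    (hxy : (x, y) ∈ R ∧ (y, x) ∉ R) :
    ∀ z ∈ C ∪ C', ((x, z) ∈ R ∧ (z, x) ∉ R) ∨ ((z, y) ∈ R ∧ (y, z) ∉ R) := by
  have hUR : {z | (x, z) ∈ R ∧ (z, x) ∉ R} ∪ {z | (z, y) ∈ R ∧ (y, z) ∉ R} =
      {z | (x, z) ∈ R} ∪ {z | (z, y) ∈ R} := by
    ext z
    constructor
    · rintro (h | h)
      · exact Or.inl h.1
      · exact Or.inr h.1
    · rintro (h | h)
      · by_cases hzx : (z, x) ∈ R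
        · exact Or.inr (hIP x z y ⟨hzx, h⟩ hxy)
        · exact Or.inl ⟨h, hzx⟩
      · by_cases hyz : (y, z) ∈ R
        · exact Or.inl (hPI y x z hxy ⟨hyz, h⟩)
        · exact Or.inr ⟨h, hyz⟩
  have hU : IsClopen ({z | (x, z) ∈ R ∧ (z, x) ∉ R} ∪ {z | (z, y) ∈ R ∧ (y, z) ∉ R}) :=
    ⟨hUR ▸ (hRupper x).union (hRlower y), (hPupper x).union (hPlower y)⟩
  obtain ⟨a, rfl⟩ := hC
  obtain ⟨b, rfl⟩ := hC'
  rintro z (hz | hz)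
  · exact isPreconnected_connectedComponent.subset_isClopen hU ⟨x, hx, Or.inr hxy⟩ hz
  · exact isPreconnected_connectedComponent.subset_isClopen hU ⟨y, hy, Or.inl hxy⟩ hz
end

section
/- Let X be a connected topological space and R a continuous binary relation on X with asymmetric part P. Then R is semi-transitive if and only if P is negatively transitive. -/
/-- Theorem 5(a)(i): for a continuous binary relation R on a connected topological
space, semi-transitivity of R is equivalent to negative transitivity of its asymmetric
part P. -/
theorem semiTrans_iff_negTrans
    {X : Type*} [TopologicalSpace X] [ConnectedSpace X] (R : Set (X × X))
    -- continuity: sections of R are closed, sections of the asymmetric part P are open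
    (hRupper : ∀ x : X, IsClosed {y | (x, y) ∈ R})
    (hRlower : ∀ x : X, IsClosed {y | (y, x) ∈ R})
    (hPupper : ∀ x : X, IsOpen {y | (x, y) ∈ R ∧ (y, x) ∉ R})
    (hPlower : ∀ x : X, IsOpen {y | (y, x) ∈ R ∧ (x, y) ∉ R}) :
    -- semi-transitivity of R ((PI) and (IP)) ...
    ((∀ x y z : X, ((y, x) ∈ R ∧ (x, y) ∉ R) → ((x, z) ∈ R ∧ (z, x) ∈ R) →
        ((y, z) ∈ R ∧ (z, y) ∉ R)) ∧
     (∀ x y z : X, ((y, x) ∈ R ∧ (x, y) ∈ R) → ((x, z) ∈ R ∧ (z, x) ∉ R) →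
        ((y, z) ∈ R ∧ (z, y) ∉ R)))
    ↔
    -- ... iff the asymmetric part P is negatively transitive
    (∀ x y z : X, ¬((x, y) ∈ R ∧ (y, x) ∉ R) → ¬((y, z) ∈ R ∧ (z, y) ∉ R) →
      ¬((x, z) ∈ R ∧ (z, x) ∉ R)) := by
  constructor
  · rintro ⟨hPI, hIP⟩ x y z hxy hyz hxz
    -- For `x P z`, the open set `P(x) ∪ P⁻¹(z)` equals the closed set `R(x) ∪ R⁻¹(z)`.
    have heq : {w | (x, w) ∈ R ∧ (w, x) ∉ R} ∪ {w | (w, z) ∈ R ∧ (z, w) ∉ R} =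
        {w | (x, w) ∈ R} ∪ {w | (w, z) ∈ R} := by
      ext w
      have hI := hIP x w z
      have hP := hPI z x w
      simp only [Set.mem_union, Set.mem_ofPred_eq]
      tauto
    have hclopen : IsClopen ({w | (x, w) ∈ R ∧ (w, x) ∉ R} ∪ {w | (w, z) ∈ R ∧ (z, w) ∉ R}) :=
      ⟨heq ▸ (hRupper x).union (hRlower z), (hPupper x).union (hPlower z)⟩
    have huniv := hclopen.eq_univ ⟨z, Or.inl hxz⟩
    have hy : y ∈ {w | (x, w) ∈ R ∧ (w, x) ∉ R} ∪ {w | (w, z) ∈ R ∧ (z, w) ∉ R} :=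
      huniv ▸ Set.mem_univ y
    exact hy.elim hxy hyz
  · intro h
    constructor
    · intro x y z hyx hxz
      by_contra hyz
      exact h y z x hyz (fun hzx => hzx.2 hxz.1) hyx
    · intro x y z hyx hxz
      by_contra hyz
      exact h x y z (fun hxy => hxy.2 hyx.1) hyz hxz
end

section
/- Let X be a connected topological space and R a continuous binary relation on X with symmetric part I. Then R is transitive if and only if R is semi-transitive and I is transitive. -/
/-- On a connected space, the asymmetric part of a continuous semi-transitive relation is
negatively transitive. -/
theorem asymm_or_asymm_of_semiTrans
    {X : Type*} [TopologicalSpace X] [ConnectedSpace X] {R : Set (X × X)}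
    (hRupper : ∀ x : X, IsClosed {y | (x, y) ∈ R})
    (hRlower : ∀ x : X, IsClosed {y | (y, x) ∈ R})
    (hPupper : ∀ x : X, IsOpen {y | (x, y) ∈ R ∧ (y, x) ∉ R})
    (hPlower : ∀ x : X, IsOpen {y | (y, x) ∈ R ∧ (x, y) ∉ R})
    (hPI : ∀ x y z : X, ((y, x) ∈ R ∧ (x, y) ∉ R) → ((x, z) ∈ R ∧ (z, x) ∈ R) →
      ((y, z) ∈ R ∧ (z, y) ∉ R))
    (hIP : ∀ x y z : X, ((y, x) ∈ R ∧ (x, y) ∈ R) → ((x, z) ∈ R ∧ (z, x) ∉ R) →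
      ((y, z) ∈ R ∧ (z, y) ∉ R))
    {x y : X} (hxy : (x, y) ∈ R ∧ (y, x) ∉ R) (w : X) :
    ((x, w) ∈ R ∧ (w, x) ∉ R) ∨ ((w, y) ∈ R ∧ (y, w) ∉ R) := by
  have heq : {w | (x, w) ∈ R ∧ (w, x) ∉ R} ∪ {w | (w, y) ∈ R ∧ (y, w) ∉ R} =
      {w | (x, w) ∈ R} ∪ {w | (w, y) ∈ R} := by
    refine Set.Subset.antisymm (Set.union_subset_union (fun _ h => h.1) (fun _ h => h.1)) ?_
    rintro v (hv | hv)
    · by_cases hvx : (v, x) ∈ R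
      · exact Or.inr (hIP x v y ⟨hvx, hv⟩ hxy)
      · exact Or.inl ⟨hv, hvx⟩
    · by_cases hyv : (y, v) ∈ R
      · exact Or.inl (hPI y x v hxy ⟨hyv, hv⟩)
      · exact Or.inr ⟨hv, hyv⟩
  have hclopen : IsClopen
      ({w | (x, w) ∈ R ∧ (w, x) ∉ R} ∪ {w | (w, y) ∈ R ∧ (y, w) ∉ R}) :=
    ⟨heq ▸ (hRupper x).union (hRlower y), (hPupper x).union (hPlower y)⟩
  exact Set.eq_univ_iff_forall.mp (hclopen.eq_univ ⟨y, Or.inl hxy⟩) w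


/-- Theorem 5(a)(iv): for a continuous binary relation R on a connected topological
space, R is transitive if and only if R is semi-transitive and its symmetric part I is
transitive. -/
theorem trans_iff_semiTrans_and_symTrans
    {X : Type*} [TopologicalSpace X] [ConnectedSpace X] (R : Set (X × X))
    -- continuity: sections of R are closed, sections of the asymmetric part P are open
    (hRupper : ∀ x : X, IsClosed {y | (x, y) ∈ R})
    (hRlower : ∀ x : X, IsClosed {y | (y, x) ∈ R})
    (hPupper : ∀ x : X, IsOpen {y | (x, y) ∈ R ∧ (y, x) ∉ R})
    (hPlower : ∀ x : X, IsOpen {y | (y, x) ∈ R ∧ (x, y) ∉ R}) :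
    -- R is transitive ...
    (∀ x y z : X, (x, y) ∈ R → (y, z) ∈ R → (x, z) ∈ R)
    ↔
    -- ... iff R is semi-transitive ((PI) and (IP)) and I is transitive
    ((∀ x y z : X, ((y, x) ∈ R ∧ (x, y) ∉ R) → ((x, z) ∈ R ∧ (z, x) ∈ R) →
        ((y, z) ∈ R ∧ (z, y) ∉ R)) ∧
     (∀ x y z : X, ((y, x) ∈ R ∧ (x, y) ∈ R) → ((x, z) ∈ R ∧ (z, x) ∉ R) →
        ((y, z) ∈ R ∧ (z, y) ∉ R)) ∧
     (∀ x y z : X, ((x, y) ∈ R ∧ (y, x) ∈ R) → ((y, z) ∈ R ∧ (z, y) ∈ R) →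
        ((x, z) ∈ R ∧ (z, x) ∈ R))) := by
  constructor
  · intro h
    exact ⟨fun x y z hyx hxz => ⟨h y x z hyx.1 hxz.1, fun hzy => hyx.2 (h x z y hxz.1 hzy)⟩,
      fun x y z hyx hxz => ⟨h y x z hyx.1 hxz.1, fun hzy => hxz.2 (h z y x hzy hyx.1)⟩,
      fun x y z hxy hyz => ⟨h x y z hxy.1 hyz.1, h z y x hyz.2 hxy.2⟩⟩
  · rintro ⟨hPI, hIP, hI⟩ x y z hxy hyz
    by_cases hyx : (y, x) ∈ R <;> by_cases hzy : (z, y) ∈ R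
    · exact (hI x y z ⟨hxy, hyx⟩ ⟨hyz, hzy⟩).1
    · exact (hIP y x z ⟨hxy, hyx⟩ ⟨hyz, hzy⟩).1
    · exact (hPI y x z ⟨hxy, hyx⟩ ⟨hyz, hzy⟩).1
    · rcases asymm_or_asymm_of_semiTrans hRupper hRlower hPupper hPlower hPI hIP
        ⟨hyz, hzy⟩ x with h | h
      · exact absurd h.1 hyx
      · exact h.1
end

section
/- Let X be a topological space and R a continuous binary relation on X whose symmetric part I has connected sections (every set I(x) = {y : (x,y) ∈ I} is a connected subset of X). If I is transitive, then R is semi-transitive. -/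
/-- Theorem 5(b)(i): for a continuous binary relation R whose symmetric part I has
connected sections, transitivity of I implies semi-transitivity of R.  (Connectedness
of a possibly empty subset is `IsPreconnected`, matching the paper's definition.) -/
theorem symTrans_implies_semiTrans_of_connSections
    {X : Type*} [TopologicalSpace X] (R : Set (X × X))
    -- continuity: sections of R are closed, sections of the asymmetric part P are open
    (hRupper : ∀ x : X, IsClosed {y | (x, y) ∈ R})
    (hRlower : ∀ x : X, IsClosed {y | (y, x) ∈ R})
    (hPupper : ∀ x : X, IsOpen {y | (x, y) ∈ R ∧ (y, x) ∉ R})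
    (hPlower : ∀ x : X, IsOpen {y | (y, x) ∈ R ∧ (x, y) ∉ R})
    -- the sections of the symmetric part I are connected
    (hIconn : ∀ x : X, IsPreconnected {y | (x, y) ∈ R ∧ (y, x) ∈ R})
    -- the symmetric part I is transitive
    (hItrans : ∀ x y z : X, ((x, y) ∈ R ∧ (y, x) ∈ R) → ((y, z) ∈ R ∧ (z, y) ∈ R) →
      ((x, z) ∈ R ∧ (z, x) ∈ R)) :
    -- R is semi-transitive: (PI) and (IP)
    (∀ x y z : X, ((y, x) ∈ R ∧ (x, y) ∉ R) → ((x, z) ∈ R ∧ (z, x) ∈ R) →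
      ((y, z) ∈ R ∧ (z, y) ∉ R)) ∧
    (∀ x y z : X, ((y, x) ∈ R ∧ (x, y) ∈ R) → ((x, z) ∈ R ∧ (z, x) ∉ R) →
      ((y, z) ∈ R ∧ (z, y) ∉ R)) := by
  constructor
  · intro x y z hyx hxz
    have hsub : {w | (x, w) ∈ R ∧ (w, x) ∈ R} ⊆ {w | (y, w) ∈ R ∧ (w, y) ∉ R} := by
      refine (hIconn x).subset_left_of_subset_union (hPupper y) (hRupper y).isOpen_compl
        (Set.disjoint_left.2 fun w hw hw' => hw' hw.1) (fun w hw => ?_)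
        ⟨x, hItrans x z x hxz hxz.symm, hyx⟩
      by_cases hyw : (y, w) ∈ R
      · exact Or.inl ⟨hyw, fun hwy => hyx.2 (hItrans x w y hw ⟨hwy, hyw⟩).1⟩
      · exact Or.inr hyw
    exact hsub hxz
  · intro x y z hyx hxz
    have hsub : {w | (x, w) ∈ R ∧ (w, x) ∈ R} ⊆ {w | (w, z) ∈ R ∧ (z, w) ∉ R} := by
      refine (hIconn x).subset_left_of_subset_union (hPlower z) (hRlower z).isOpen_compl
        (Set.disjoint_left.2 fun w hw hw' => hw' hw.1) (fun w hw => ?_)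
        ⟨x, hItrans x y x hyx.symm hyx, hxz⟩
      by_cases hwz : (w, z) ∈ R
      · exact Or.inl ⟨hwz, fun hzw => hxz.2 (hItrans x w z hw ⟨hwz, hzw⟩).2⟩
      · exact Or.inr hwz
    exact hsub hyx.symm
end

section
/- Let X be a topological space and R a continuous binary relation on X whose symmetric part I has connected sections (every set I(x) = {y : (x,y) ∈ I} is a connected subset of X). Then R is transitive if and only if its asymmetric part P is transitive and I is transitive. -/
/-- If an open set `u` and a larger closed set `c` have the same trace on a preconnected set `s`
that meets `u`, then `s` is contained in `u`. -/
theorem IsPreconnected.subset_of_inter_isClosed_subset {X : Type*} [TopologicalSpace X]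
    {s u c : Set X} (hs : IsPreconnected s) (hu : IsOpen u) (hc : IsClosed c) (huc : u ⊆ c)
    (hsc : s ∩ c ⊆ u) (hsu : (s ∩ u).Nonempty) : s ⊆ u := by
  refine hs.subset_left_of_subset_union hu hc.isOpen_compl
    (Set.disjoint_compl_right_iff_subset.2 huc) (fun w hw => ?_) hsu
  by_cases hwc : w ∈ c
  · exact Or.inl (hsc ⟨hw, hwc⟩)
  · exact Or.inr hwc


/-- Theorem 5(b)(ii): for a continuous binary relation R whose symmetric part I has
connected sections, R is transitive if and only if its asymmetric part P is transitive
and I is transitive. -/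
theorem trans_iff_asymTrans_and_symTrans_of_connSections
    {X : Type*} [TopologicalSpace X] (R : Set (X × X))
    -- continuity: sections of R are closed, sections of the asymmetric part P are open
    (hRupper : ∀ x : X, IsClosed {y | (x, y) ∈ R})
    (hRlower : ∀ x : X, IsClosed {y | (y, x) ∈ R})
    (hPupper : ∀ x : X, IsOpen {y | (x, y) ∈ R ∧ (y, x) ∉ R})
    (hPlower : ∀ x : X, IsOpen {y | (y, x) ∈ R ∧ (x, y) ∉ R})
    -- the sections of the symmetric part I are connected
    (hIconn : ∀ x : X, IsPreconnected {y | (x, y) ∈ R ∧ (y, x) ∈ R}) :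
    -- R is transitive ...
    (∀ x y z : X, (x, y) ∈ R → (y, z) ∈ R → (x, z) ∈ R)
    ↔
    -- ... iff P is transitive and I is transitive
    ((∀ x y z : X, ((x, y) ∈ R ∧ (y, x) ∉ R) → ((y, z) ∈ R ∧ (z, y) ∉ R) →
        ((x, z) ∈ R ∧ (z, x) ∉ R)) ∧
     (∀ x y z : X, ((x, y) ∈ R ∧ (y, x) ∈ R) → ((y, z) ∈ R ∧ (z, y) ∈ R) →
        ((x, z) ∈ R ∧ (z, x) ∈ R))) := by
  constructor
  · intro hR
    refine ⟨fun x y z hxy hyz => ⟨hR x y z hxy.1 hyz.1, fun hzx => ?_⟩, fun x y z hxy hyz =>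
      ⟨hR x y z hxy.1 hyz.1, hR z y x hyz.2 hxy.2⟩⟩
    exact hyz.2 (hR z x y hzx hxy.1)
  · rintro ⟨hP, hI⟩ x y z hxy hyz
    by_cases hyx : (y, x) ∈ R <;> by_cases hzy : (z, y) ∈ R
    · exact (hI x y z ⟨hxy, hyx⟩ ⟨hyz, hzy⟩).1
    · have hsub := (hIconn y).subset_of_inter_isClosed_subset (hPlower z) (hRlower z)
        (fun w hw => hw.1)
        (fun w hw => ⟨hw.2, fun hzw => hzy (hI y w z hw.1 ⟨hw.2, hzw⟩).2⟩)
        ⟨y, hI y x y ⟨hyx, hxy⟩ ⟨hxy, hyx⟩, hyz, hzy⟩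
      exact (hsub ⟨hyx, hxy⟩).1
    · have hsub := (hIconn y).subset_of_inter_isClosed_subset (hPupper x) (hRupper x)
        (fun w hw => hw.1)
        (fun w hw => ⟨hw.2, fun hwx => hyx (hI y w x hw.1 ⟨hwx, hw.2⟩).1⟩)
        ⟨y, hI y z y ⟨hyz, hzy⟩ ⟨hzy, hyz⟩, hxy, hyx⟩
      exact (hsub ⟨hyz, hzy⟩).1
    · exact (hP x y z ⟨hxy, hyx⟩ ⟨hyz, hzy⟩).1
end

section
/- Let X be a topological space with at most two connected components and R a complete, continuous, semi-transitive binary relation on X. Then R is transitive. -/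
/-- On a topological space with at most two connected components, every complete,
continuous and semi-transitive binary relation is transitive. -/
theorem complete_semiTrans_twoComponents_trans
    {X : Type*} [TopologicalSpace X] (R : Set (X × X))
    -- X has at most two connected components
    (htwo : ∀ x y z : X, connectedComponent x = connectedComponent y ∨
      connectedComponent x = connectedComponent z ∨
      connectedComponent y = connectedComponent z)
    -- completeness
    (hcomp : ∀ x y : X, (x, y) ∈ R ∨ (y, x) ∈ R)
    -- continuity: sections of R are closed, sections of the asymmetric part P are open
    (hRupper : ∀ x : X, IsClosed {y | (x, y) ∈ R})
    (hRlower : ∀ x : X, IsClosed {y | (y, x) ∈ R})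
    (hPupper : ∀ x : X, IsOpen {y | (x, y) ∈ R ∧ (y, x) ∉ R})
    (hPlower : ∀ x : X, IsOpen {y | (y, x) ∈ R ∧ (x, y) ∉ R})
    -- semi-transitivity: (PI) and (IP)
    (hPI : ∀ x y z : X, ((y, x) ∈ R ∧ (x, y) ∉ R) → ((x, z) ∈ R ∧ (z, x) ∈ R) →
      ((y, z) ∈ R ∧ (z, y) ∉ R))
    (hIP : ∀ x y z : X, ((y, x) ∈ R ∧ (x, y) ∈ R) → ((x, z) ∈ R ∧ (z, x) ∉ R) →
      ((y, z) ∈ R ∧ (z, y) ∉ R)) :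
    ∀ x y z : X, (x, y) ∈ R → (y, z) ∈ R → (x, z) ∈ R := by
  have clopen : ∀ a b c : X, (b, a) ∉ R → (c, b) ∉ R → (a, c) ∉ R →
      b ∈ {t | (a, t) ∈ R} ∩ {t | (t, c) ∈ R} ∧
        IsClopen ({t | (a, t) ∈ R} ∩ {t | (t, c) ∈ R}) := by
    intro a b c hba hcb hac
    refine ⟨⟨(hcomp a b).resolve_right hba, (hcomp b c).resolve_right hcb⟩,
      (hRupper a).inter (hRlower c), ?_⟩
    have hca := (hcomp a c).resolve_left hac
    have strict : {t | (a, t) ∈ R} ∩ {t | (t, c) ∈ R} =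
        {t | (a, t) ∈ R ∧ (t, a) ∉ R} ∩ {t | (t, c) ∈ R ∧ (c, t) ∉ R} := by
      ext t
      refine ⟨fun ⟨hat, htc⟩ => ⟨⟨hat, fun hta => ?_⟩, ⟨htc, fun hct => ?_⟩⟩,
        fun ⟨hat, htc⟩ => ⟨hat.1, htc.1⟩⟩
      · exact (hPI a c t ⟨hca, hac⟩ ⟨hat, hta⟩).2 htc
      · exact (hIP c t a ⟨htc, hct⟩ ⟨hca, hac⟩).2 hat
    rw [strict]
    exact (hPupper a).inter (hPlower c)
  have separated : ∀ a b c : X, (b, a) ∉ R → (c, b) ∉ R → (a, c) ∉ R →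
      connectedComponent c ≠ connectedComponent b := by
    intro a b c hba hcb hac h
    obtain ⟨hb, hU⟩ := clopen a b c hba hcb hac
    exact hac (hU.connectedComponent_subset hb (h ▸ mem_connectedComponent)).1
  intro x y z hxy hyz
  by_contra hxz
  have hzx := (hcomp x z).resolve_left hxz
  have hyx : (y, x) ∉ R := fun hyx => (hPI x z y ⟨hzx, hxz⟩ ⟨hxy, hyx⟩).2 hyz
  have hzy : (z, y) ∉ R := fun hzy => (hIP z y x ⟨hyz, hzy⟩ ⟨hzx, hxz⟩).2 hxy
  rcases htwo x y z with h | h | h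
  · exact separated z x y hxz hyx hzy h.symm
  · exact separated y z x hzy hxz hyx h
  · exact separated x y z hyx hzy hxz h.symm
end

section
/- Let X be a topological space with the Phragmen-Brouwer property and R a continuous binary relation on X whose upper sections R(x) are all path-connected. If the symmetric part I of R is transitive, then condition (PI) holds: (y,x) ∈ P and (x,z) ∈ I imply (y,z) ∈ P, where P is the asymmetric part of R. -/
/-- A preconnected set joining two points that a set `S` separates must meet `S`. -/
theorem IsPreconnected.inter_nonempty_of_connectedComponentIn_compl_ne
    {X : Type*} [TopologicalSpace X] {S T : Set X} {a b : X} (hT : IsPreconnected T)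
    (ha : a ∈ T) (hb : b ∈ T)
    (hS : _root_.connectedComponentIn Sᶜ a ≠ _root_.connectedComponentIn Sᶜ b) : ∃ s ∈ S, s ∈ T := by
  by_contra! h
  have hTS : T ⊆ Sᶜ := fun t ht hts => h t hts ht
  exact hS (connectedComponentIn_eq (hT.subset_connectedComponentIn ha hTS hb))

/-- Suppose the upper section of `R` at `w` is closed and that of its asymmetric part is open.
A preconnected set that meets the upper section of `R` but not that of the symmetric part
lies in the upper section of the asymmetric part. -/
theorem IsPreconnected.subset_asymm_upper_section
    {X : Type*} [TopologicalSpace X] {R : Set (X × X)} {S : Set X} {w : X}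
    (hS : IsPreconnected S) (hR : IsClosed {y | (w, y) ∈ R})
    (hP : IsOpen {y | (w, y) ∈ R ∧ (y, w) ∉ R})
    (hne : ∃ s ∈ S, (w, s) ∈ R) (hI : ∀ s ∈ S, ¬((w, s) ∈ R ∧ (s, w) ∈ R)) :
    ∀ s ∈ S, (w, s) ∈ R ∧ (s, w) ∉ R := by
  obtain ⟨s, hs, hws⟩ := hne
  refine hS.subset_left_of_subset_union hP hR.isOpen_compl ?_ ?_
    ⟨s, hs, hws, fun h => hI s hs ⟨hws, h⟩⟩
  · exact Set.disjoint_left.2 fun _ h h' => h' h.1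
  · intro t ht
    by_cases h : (w, t) ∈ R
    · exact Or.inl ⟨h, fun h' => hI t ht ⟨h, h'⟩⟩
    · exact Or.inr h


/-- Theorem 6(i): on a topological space with the Phragmen-Brouwer property, for a
continuous binary relation R with path-connected upper sections, transitivity of the
symmetric part I implies condition (PI). -/
theorem pbp_pathConnUpper_symTrans_implies_PI
    {X : Type*} [TopologicalSpace X]
    -- the Phragmen-Brouwer property: for all separated non-empty open sets A, B and all
    -- x ∈ A, y ∈ B there is a connected subset of X \ (A ∪ B) separating x from y
    (hPBP : ∀ A B : Set X, IsOpen A → IsOpen B → A.Nonempty → B.Nonempty →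
      closure A ∩ B = ∅ → A ∩ closure B = ∅ → ∀ x ∈ A, ∀ y ∈ B,
        ∃ S : Set X, S ⊆ (A ∪ B)ᶜ ∧ IsPreconnected S ∧
          connectedComponentIn Sᶜ x ≠ connectedComponentIn Sᶜ y)
    (R : Set (X × X))
    -- continuity: sections of R are closed, sections of the asymmetric part P are open
    (hRupper : ∀ x : X, IsClosed {y | (x, y) ∈ R})
    (hRlower : ∀ x : X, IsClosed {y | (y, x) ∈ R})
    (hPupper : ∀ x : X, IsOpen {y | (x, y) ∈ R ∧ (y, x) ∉ R})
    (hPlower : ∀ x : X, IsOpen {y | (y, x) ∈ R ∧ (x, y) ∉ R})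
    -- the upper sections of R are path-connected
    (hpath : ∀ x : X, ∀ y ∈ {w | (x, w) ∈ R}, ∀ z ∈ {w | (x, w) ∈ R},
      JoinedIn {w | (x, w) ∈ R} y z)
    -- the symmetric part I is transitive
    (hItrans : ∀ x y z : X, ((x, y) ∈ R ∧ (y, x) ∈ R) → ((y, z) ∈ R ∧ (z, y) ∈ R) →
      ((x, z) ∈ R ∧ (z, x) ∈ R)) :
    -- (PI) holds
    ∀ x y z : X, ((y, x) ∈ R ∧ (x, y) ∉ R) → ((x, z) ∈ R ∧ (z, x) ∈ R) →
      ((y, z) ∈ R ∧ (z, y) ∉ R) := by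
  have hconn (w : X) : IsPreconnected {v | (w, v) ∈ R} :=
    isPreconnected_of_forall_pair fun a ha b hb => by
      obtain ⟨γ, hγ⟩ := hpath w a ha b hb
      exact ⟨Set.range γ, Set.range_subset_iff.2 hγ, ⟨0, γ.source⟩, ⟨1, γ.target⟩,
        isPreconnected_range γ.continuous⟩
  have hsep (u a b : X) (ha : (u, a) ∈ R ∧ (a, u) ∉ R) (hb : (u, b) ∉ R) :
      ∃ S : Set X, (∀ s ∈ S, (u, s) ∈ R ∧ (s, u) ∈ R) ∧ IsPreconnected S ∧
        connectedComponentIn Sᶜ a ≠ connectedComponentIn Sᶜ b := by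
    have hB : IsOpen {v | (u, v) ∈ R}ᶜ := (hRupper u).isOpen_compl
    have hdisj : Disjoint {v | (u, v) ∈ R ∧ (v, u) ∉ R} {v | (u, v) ∈ R}ᶜ :=
      Set.disjoint_left.2 fun _ h h' => h' h.1
    obtain ⟨S, hS, hSc, hne⟩ := hPBP _ _ (hPupper u) hB ⟨a, ha⟩ ⟨b, hb⟩
      (hdisj.closure_left hB).inter_eq (hdisj.closure_right (hPupper u)).inter_eq a ha b hb
    refine ⟨S, fun s hs => ?_, hSc, hne⟩
    have h := hS hs
    simp only [Set.mem_compl_iff, Set.mem_union, Set.mem_ofPred_eq] at h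
    tauto
  intro x y z hyx hxz
  by_contra hyz
  have hyz' : (y, z) ∉ R := fun h =>
    hyx.2 (hItrans y z x ⟨h, by tauto⟩ hxz.symm).2
  have hxx := hItrans x z x hxz hxz.symm
  obtain ⟨S, hSI, hSc, hSne⟩ := hsep y x z hyx hyz'
  have hSx : ∀ s ∈ S, (x, s) ∈ R ∧ (s, x) ∉ R :=
    hSc.subset_asymm_upper_section (hRupper x) (hPupper x)
      ((hconn x).inter_nonempty_of_connectedComponentIn_compl_ne hxx.1 hxz.1 hSne)
      fun s hs h => hyx.2 (hItrans y s x (hSI s hs) h.symm).2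
  obtain ⟨s₀, hs₀, -⟩ :=
    (hconn x).inter_nonempty_of_connectedComponentIn_compl_ne hxx.1 hxz.1 hSne
  obtain ⟨T, hTI, hTc, hTne⟩ := hsep x s₀ y (hSx s₀ hs₀) hyx.2
  have hST : S ⊆ Tᶜ := fun s hs hsT => (hSx s hs).2 (hTI s hsT).2
  have hTmeet : ∀ s ∈ S, ∃ t ∈ T, (s, t) ∈ R := fun s hs => by
    refine (hconn s).inter_nonempty_of_connectedComponentIn_compl_ne
      (hItrans s y s (hSI s hs).symm (hSI s hs)).1 (hSI s hs).2 ?_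
    rwa [← connectedComponentIn_eq (hSc.subset_connectedComponentIn hs₀ hST hs)]
  have hTS : ∀ s ∈ S, ∀ t ∈ T, (s, t) ∈ R ∧ (t, s) ∉ R := fun s hs =>
    hTc.subset_asymm_upper_section (hRupper s) (hPupper s) (hTmeet s hs)
      fun t ht h => (hSx s hs).2 (hItrans x t s (hTI t ht) h.symm).2
  obtain ⟨t, ht, -⟩ := hTmeet s₀ hs₀
  obtain ⟨s, hs, hts⟩ := (hconn t).inter_nonempty_of_connectedComponentIn_compl_ne
    (hTI t ht).2 (hItrans t x z (hTI t ht).symm hxz).1 hSne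
  exact (hTS s hs t ht).2 hts
end

section
/- Let X be a topological space with the Phragmen-Brouwer property and R a continuous binary relation on X whose upper sections R(x) and lower sections R⁻¹(x) are all path-connected. Then R is transitive if and only if its asymmetric part P is transitive and its symmetric part I is transitive. -/
/-- If the asymmetric and symmetric parts of `R` are transitive, the upper sections of `R` are closed
and path-connected, and those of its asymmetric part are open, then a strict step followed by a
symmetric step is a step of `R`. -/
theorem rel_of_asymm_of_symm {X : Type*} [TopologicalSpace X] (R : Set (X × X))
    (hR : ∀ x : X, IsClosed {y | (x, y) ∈ R})
    (hP : ∀ x : X, IsOpen {y | (x, y) ∈ R ∧ (y, x) ∉ R})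
    (hpath : ∀ x : X, ∀ y ∈ {w | (x, w) ∈ R}, ∀ z ∈ {w | (x, w) ∈ R},
      JoinedIn {w | (x, w) ∈ R} y z)
    (hPtrans : ∀ x y z : X, ((x, y) ∈ R ∧ (y, x) ∉ R) → ((y, z) ∈ R ∧ (z, y) ∉ R) →
      ((x, z) ∈ R ∧ (z, x) ∉ R))
    (hItrans : ∀ x y z : X, ((x, y) ∈ R ∧ (y, x) ∈ R) → ((y, z) ∈ R ∧ (z, y) ∈ R) →
      ((x, z) ∈ R ∧ (z, x) ∈ R))
    {x y z : X} (hxy : (x, y) ∈ R) (hyx : (y, x) ∉ R) (hyz : (y, z) ∈ R) (hzy : (z, y) ∈ R) :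
    (x, z) ∈ R := by
  have hyy : (y, y) ∈ R := (hItrans y z y ⟨hyz, hzy⟩ ⟨hzy, hyz⟩).1
  have hconn : IsPreconnected {w | (y, w) ∈ R} :=
    IsPathConnected.isConnected ⟨y, hyy, fun w hw => hpath y y hyy w hw⟩ |>.isPreconnected
  have hnot : ∀ s, (y, s) ∈ R → (s, x) ∉ R := by
    intro s hys hsx
    have h₁ := hPtrans x y s
    have h₂ := hItrans x s y
    have h₃ := hPtrans s x y
    tauto
  have hsub : {w | (y, w) ∈ R} ⊆ {w | (x, w) ∈ R ∧ (w, x) ∉ R} := by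
    refine hconn.subset_left_of_subset_union (hP x) (hR x).isOpen_compl ?_ ?_
      ⟨y, hyy, hxy, hyx⟩
    · exact Set.disjoint_left.2 fun w hw hw' => hw' hw.1
    · intro w hw
      by_cases h : (x, w) ∈ R
      · exact Or.inl ⟨h, hnot w hw⟩
      · exact Or.inr h
  exact (hsub hyz).1


/-- Theorem 6(iii): on a topological space with the Phragmen-Brouwer property, a
continuous binary relation R with path-connected upper and lower sections is transitive
if and only if its asymmetric part P and its symmetric part I are transitive. -/
theorem pbp_pathConnSections_trans_iff
    {X : Type*} [TopologicalSpace X]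
    -- the Phragmen-Brouwer property
    (hPBP : ∀ A B : Set X, IsOpen A → IsOpen B → A.Nonempty → B.Nonempty →
      closure A ∩ B = ∅ → A ∩ closure B = ∅ → ∀ x ∈ A, ∀ y ∈ B,
        ∃ S : Set X, S ⊆ (A ∪ B)ᶜ ∧ IsPreconnected S ∧
          connectedComponentIn Sᶜ x ≠ connectedComponentIn Sᶜ y)
    (R : Set (X × X))
    -- continuity: sections of R are closed, sections of the asymmetric part P are open
    (hRupper : ∀ x : X, IsClosed {y | (x, y) ∈ R})
    (hRlower : ∀ x : X, IsClosed {y | (y, x) ∈ R})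
    (hPupper : ∀ x : X, IsOpen {y | (x, y) ∈ R ∧ (y, x) ∉ R})
    (hPlower : ∀ x : X, IsOpen {y | (y, x) ∈ R ∧ (x, y) ∉ R})
    -- the upper and lower sections of R are path-connected
    (hpathUpper : ∀ x : X, ∀ y ∈ {w | (x, w) ∈ R}, ∀ z ∈ {w | (x, w) ∈ R},
      JoinedIn {w | (x, w) ∈ R} y z)
    (hpathLower : ∀ x : X, ∀ y ∈ {w | (w, x) ∈ R}, ∀ z ∈ {w | (w, x) ∈ R},
      JoinedIn {w | (w, x) ∈ R} y z) :
    -- R is transitive ...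
    (∀ x y z : X, (x, y) ∈ R → (y, z) ∈ R → (x, z) ∈ R)
    ↔
    -- ... iff P is transitive and I is transitive
    ((∀ x y z : X, ((x, y) ∈ R ∧ (y, x) ∉ R) → ((y, z) ∈ R ∧ (z, y) ∉ R) →
        ((x, z) ∈ R ∧ (z, x) ∉ R)) ∧
     (∀ x y z : X, ((x, y) ∈ R ∧ (y, x) ∈ R) → ((y, z) ∈ R ∧ (z, y) ∈ R) →
        ((x, z) ∈ R ∧ (z, x) ∈ R))) := by
  constructor
  · intro hT
    refine ⟨fun x y z hxy hyz => ⟨hT x y z hxy.1 hyz.1, fun hzx => ?_⟩,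
      fun x y z hxy hyz => ⟨hT x y z hxy.1 hyz.1, hT z y x hyz.2 hxy.2⟩⟩
    exact hxy.2 (hT y z x hyz.1 hzx)
  · rintro ⟨hPtrans, hItrans⟩ x y z hxy hyz
    by_cases hyx : (y, x) ∈ R <;> by_cases hzy : (z, y) ∈ R
    · exact (hItrans x y z ⟨hxy, hyx⟩ ⟨hyz, hzy⟩).1
    · exact rel_of_asymm_of_symm (Prod.swap ⁻¹' R) hRlower hPlower hpathLower
        (fun a b c hab hbc => hPtrans c b a hbc hab)
        (fun a b c hab hbc => hItrans c b a hbc hab)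
        (x := z) (y := y) (z := x) hyz hzy hxy hyx
    · exact rel_of_asymm_of_symm R hRupper hPupper hpathUpper hPtrans hItrans hxy hyx hyz hzy
    · exact (hPtrans x y z ⟨hxy, hyx⟩ ⟨hyz, hzy⟩).1
end

section
/- Let X be a connected topological space. Then any two anti-symmetric, non-trivial and continuous binary relations R₁ and R₂ on X are either identical or inverse to each other, i.e. R₁ = R₂ or R₁ = R₂⁻¹ (where R₂⁻¹ = {(x,y) : (y,x) ∈ R₂}). -/
/-- An anti-symmetric relation whose sections are closed, and are open once the base point is
removed. -/
structure IsContinuousAntisymm {X : Type*} [TopologicalSpace X] (r : X → X → Prop) : Prop where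
  antisymm : ∀ x y, r x y → r y x → x = y
  closed_upper : ∀ x, IsClosed {y | r x y}
  closed_lower : ∀ x, IsClosed {y | r y x}
  open_upper : ∀ x, IsOpen {y | r x y ∧ y ≠ x}
  open_lower : ∀ x, IsOpen {y | r y x ∧ y ≠ x}

/-- In a connected space, a closed set that is open away from one of its points `x` lies in any
open neighbourhood of `x` whose trace on it is closed. -/
theorem subset_of_isOpen_diff_singleton {X : Type*} [TopologicalSpace X] [PreconnectedSpace X]
    {C O K : Set X} {x : X} (hC : IsClosed C) (hCx : IsOpen (C \ {x})) (hO : IsOpen O)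
    (hK : IsClosed K) (hx : x ∈ O) (h : C ∩ O = C ∩ K) : C ⊆ O := by
  have hEq : C \ O = (C \ {x}) \ K := by
    ext w
    have hw := Set.ext_iff.mp h w
    simp only [Set.mem_inter_iff, Set.mem_sdiff, Set.mem_singleton_iff] at hw ⊢
    grind
  have hclopen : IsClopen (C \ O) :=
    ⟨hC.sdiff hO, hEq ▸ hCx.sdiff hK⟩
  rcases isClopen_iff.mp hclopen with h0 | h1
  · exact Set.sdiff_eq_empty.mp h0
  · exact absurd hx (h1 ▸ Set.mem_univ x : x ∈ C \ O).2

namespace IsContinuousAntisymm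

variable {X : Type*} [TopologicalSpace X] {r s : X → X → Prop}

theorem of_asymmetric_part {R : Set (X × X)}
    (hAS : ∀ x y : X, (x, y) ∈ R → (y, x) ∈ R → x = y)
    (hRupper : ∀ x : X, IsClosed {y | (x, y) ∈ R})
    (hRlower : ∀ x : X, IsClosed {y | (y, x) ∈ R})
    (hPupper : ∀ x : X, IsOpen {y | (x, y) ∈ R ∧ (y, x) ∉ R})
    (hPlower : ∀ x : X, IsOpen {y | (y, x) ∈ R ∧ (x, y) ∉ R}) :
    IsContinuousAntisymm fun x y => (x, y) ∈ R where
  antisymm := hAS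
  closed_upper := hRupper
  closed_lower := hRlower
  open_upper x := by
    convert hPupper x using 3 with y
    grind
  open_lower x := by
    convert hPlower x using 3 with y
    grind

theorem flip (h : IsContinuousAntisymm r) : IsContinuousAntisymm (flip r) :=
  ⟨fun x y hxy hyx => h.antisymm x y hyx hxy, h.closed_lower, h.closed_upper, h.open_lower,
    h.open_upper⟩

theorem agree_symm (hr : IsContinuousAntisymm r) (hs : IsContinuousAntisymm s)
    (hrt : ∀ a b, r a b ∨ r b a) (hst : ∀ a b, s a b ∨ s b a) {x y : X} (hne : x ≠ y) :
    (r x y ↔ s x y) ↔ (r y x ↔ s y x) := by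
  have := hrt x y
  have := hst x y
  have := hr.antisymm x y
  have := hs.antisymm x y
  grind

variable [PreconnectedSpace X]

theorem refl_left (h : IsContinuousAntisymm r) {x y : X} (hxy : r x y) : r x x := by
  by_contra hx
  have hEq : {w | r x w} = {w | r x w ∧ w ≠ x} := by
    ext w
    simp only [Set.mem_ofPred_eq]
    grind
  have hclopen : IsClopen {w | r x w} := ⟨h.closed_upper x, hEq ▸ h.open_upper x⟩
  have huniv := hclopen.eq_univ ⟨y, hxy⟩
  exact hx (huniv ▸ Set.mem_univ x : x ∈ {w | r x w})

theorem comparable_of_rel (h : IsContinuousAntisymm r) {x y : X} (hxy : r x y) (hne : x ≠ y)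
    (z : X) : r x z ∨ r z x := by
  by_contra! hz
  have hx : r x x := h.refl_left hxy
  have hy : r y y := h.flip.refl_left hxy
  have hsub : {w | r x w ∧ w ≠ x}ᶜ ⊆ {w | r w y ∧ w ≠ y} := by
    refine subset_of_isOpen_diff_singleton (x := x) (h.open_upper x).isClosed_compl ?_
      (h.open_lower y) (h.closed_lower y) ⟨hxy, hne⟩ ?_
    · convert (h.closed_upper x).isOpen_compl using 1
      ext w
      simp only [Set.mem_sdiff, Set.mem_compl_iff, Set.mem_ofPred_eq, Set.mem_singleton_iff]
      grind
    · ext w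
      simp only [Set.mem_inter_iff, Set.mem_compl_iff, Set.mem_ofPred_eq]
      grind
  have hzy : r z y := (hsub (fun hw => hz.1 hw.1 : z ∈ {w | r x w ∧ w ≠ x}ᶜ)).1
  have hEq : {w | r x w} ∩ {w | r z w} = {w | r x w ∧ w ≠ x} ∩ {w | r z w ∧ w ≠ z} := by
    ext w
    simp only [Set.mem_inter_iff, Set.mem_ofPred_eq]
    grind
  have hclopen : IsClopen ({w | r x w} ∩ {w | r z w}) :=
    ⟨(h.closed_upper x).inter (h.closed_upper z),
      hEq ▸ (h.open_upper x).inter (h.open_upper z)⟩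
  have huniv := hclopen.eq_univ ⟨y, hxy, hzy⟩
  exact hz.2 (huniv ▸ Set.mem_univ x : x ∈ {w | r x w} ∩ {w | r z w}).2

theorem total_of_rel (h : IsContinuousAntisymm r) {x y : X} (hxy : r x y) (hne : x ≠ y)
    (a b : X) : r a b ∨ r b a := by
  rcases eq_or_ne x a with rfl | ha
  · exact h.comparable_of_rel hxy hne b
  · rcases h.comparable_of_rel hxy hne a with hxa | hax
    · exact (h.flip.comparable_of_rel hxa ha.symm b).symm
    · exact h.comparable_of_rel hax ha.symm b

theorem rel_of_separated (hr : IsContinuousAntisymm r) (hs : IsContinuousAntisymm s) {x y z : X}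
    (hsx : s x x) (hy : y ≠ x) (hrxy : r x y) (hsxy : s x y) (hsxz : ¬ s x z) : r z y := by
  have hrx : r x x := hr.refl_left hrxy
  have hsub : ({w | r x w ∧ w ≠ x} ∩ {w | s x w ∧ w ≠ x})ᶜ ⊆ {w | r w y ∧ w ≠ y} := by
    refine subset_of_isOpen_diff_singleton (x := x)
      ((hr.open_upper x).inter (hs.open_upper x)).isClosed_compl ?_
      (hr.open_lower y) (hr.closed_lower y) ⟨hrxy, hy.symm⟩ ?_
    · convert ((hr.closed_upper x).inter (hs.closed_upper x)).isOpen_compl using 1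
      ext w
      simp only [Set.mem_sdiff, Set.mem_compl_iff, Set.mem_inter_iff, Set.mem_ofPred_eq,
        Set.mem_singleton_iff]
      grind
    · ext w
      simp only [Set.mem_inter_iff, Set.mem_compl_iff, Set.mem_ofPred_eq]
      grind
  exact (hsub (fun hw => hsxz hw.2.1)).1

theorem rel_of_same_side (hr : IsContinuousAntisymm r) (hs : IsContinuousAntisymm s)
    (hst : ∀ a b, s a b ∨ s b a) {x y z : X} (hy : y ≠ x) (hz : z ≠ x)
    (hrxy : r x y) (hrxz : r x z) (hsxy : s x y) : s x z := by
  by_contra hsxz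
  have hsx : s x x := hs.refl_left hsxy
  have hszx : s z x := (hst x z).resolve_left hsxz
  have hsyx : ¬ s y x := fun hyx => hy (hs.antisymm y x hyx hsxy)
  have hzy : r z y := hr.rel_of_separated hs hsx hy hrxy hsxy hsxz
  have hyz : r y z := hr.rel_of_separated hs.flip hsx hz hrxz hszx hsyx
  exact hsxz (hr.antisymm y z hyz hzy ▸ hsxy)

theorem agree_iff_agree (hr : IsContinuousAntisymm r) (hs : IsContinuousAntisymm s)
    (hrt : ∀ a b, r a b ∨ r b a) (hst : ∀ a b, s a b ∨ s b a) {x y z : X}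
    (hy : y ≠ x) (hz : z ≠ x) : (r x y ↔ s x y) ↔ (r x z ↔ s x z) := by
  have hrt' : ∀ a b, _root_.flip r a b ∨ _root_.flip r b a := fun a b => hrt b a
  have hst' : ∀ a b, _root_.flip s a b ∨ _root_.flip s b a := fun a b => hst b a
  have h₁ := hr.rel_of_same_side hs hst hy hz
  have h₂ := hr.flip.rel_of_same_side hs hst hy hz
  have h₃ := hr.rel_of_same_side hs.flip hst' hy hz
  have h₄ := hr.flip.rel_of_same_side hs.flip hst' hy hz
  have h₅ := hs.rel_of_same_side hr hrt hy hz
  have h₆ := hs.flip.rel_of_same_side hr hrt hy hz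
  have h₇ := hs.rel_of_same_side hr.flip hrt' hy hz
  have h₈ := hs.flip.rel_of_same_side hr.flip hrt' hy hz
  simp only [_root_.flip] at h₁ h₂ h₃ h₄ h₅ h₆ h₇ h₈
  have := hrt x y
  have := hrt x z
  have := hst x y
  have := hst x z
  have := hr.antisymm x y
  have := hr.antisymm x z
  have := hs.antisymm x y
  have := hs.antisymm x z
  grind

theorem agree_of_agree (hr : IsContinuousAntisymm r) (hs : IsContinuousAntisymm s)
    (hrt : ∀ a b, r a b ∨ r b a) (hst : ∀ a b, s a b ∨ s b a) {x y : X} (hne : x ≠ y)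
    (hxy : r x y ↔ s x y) (a b : X) : r a b ↔ s a b := by
  rcases eq_or_ne a b with rfl | hab
  · exact iff_of_true (or_self_iff.mp (hrt a a)) (or_self_iff.mp (hst a a))
  rcases eq_or_ne a x with rfl | hax
  · exact (hr.agree_iff_agree hs hrt hst hne.symm hab.symm).mp hxy
  · exact (hr.agree_iff_agree hs hrt hst hax.symm hab.symm).mp <|
      (hr.agree_symm hs hrt hst hax.symm).mp <|
      (hr.agree_iff_agree hs hrt hst hne.symm hax).mp hxy

end IsContinuousAntisymm


/-- Theorem 4, (a) ⇒ (c) (after Eilenberg): on a connected topological space, any two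
anti-symmetric, non-trivial and continuous binary relations are either identical or
inverse to each other. -/
theorem connected_antisymm_relations_identical_or_inverse
    {X : Type*} [TopologicalSpace X] [ConnectedSpace X]
    (R₁ R₂ : Set (X × X))
    -- R₁ is anti-symmetric, non-trivial and continuous
    (hAS₁ : ∀ x y : X, (x, y) ∈ R₁ → (y, x) ∈ R₁ → x = y)
    (hNT₁ : ∃ x y : X, (x, y) ∈ R₁ ∧ (y, x) ∉ R₁)
    (hRupper₁ : ∀ x : X, IsClosed {y | (x, y) ∈ R₁})
    (hRlower₁ : ∀ x : X, IsClosed {y | (y, x) ∈ R₁})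
    (hPupper₁ : ∀ x : X, IsOpen {y | (x, y) ∈ R₁ ∧ (y, x) ∉ R₁})
    (hPlower₁ : ∀ x : X, IsOpen {y | (y, x) ∈ R₁ ∧ (x, y) ∉ R₁})
    -- R₂ is anti-symmetric, non-trivial and continuous
    (hAS₂ : ∀ x y : X, (x, y) ∈ R₂ → (y, x) ∈ R₂ → x = y)
    (hNT₂ : ∃ x y : X, (x, y) ∈ R₂ ∧ (y, x) ∉ R₂)
    (hRupper₂ : ∀ x : X, IsClosed {y | (x, y) ∈ R₂})
    (hRlower₂ : ∀ x : X, IsClosed {y | (y, x) ∈ R₂})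
    (hPupper₂ : ∀ x : X, IsOpen {y | (x, y) ∈ R₂ ∧ (y, x) ∉ R₂})
    (hPlower₂ : ∀ x : X, IsOpen {y | (y, x) ∈ R₂ ∧ (x, y) ∉ R₂}) :
    R₁ = R₂ ∨ R₁ = {p : X × X | (p.2, p.1) ∈ R₂} := by
  have h₁ := IsContinuousAntisymm.of_asymmetric_part hAS₁ hRupper₁ hRlower₁ hPupper₁ hPlower₁
  have h₂ := IsContinuousAntisymm.of_asymmetric_part hAS₂ hRupper₂ hRlower₂ hPupper₂ hPlower₂
  obtain ⟨x, y, hxy, hyx⟩ := hNT₁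
  obtain ⟨u, v, huv, hvu⟩ := hNT₂
  have hne : x ≠ y := by
    rintro rfl
    exact hyx hxy
  have hne' : u ≠ v := by
    rintro rfl
    exact hvu huv
  have ht₁ := h₁.total_of_rel hxy hne
  have ht₂ := h₂.total_of_rel huv hne'
  rcases ht₂ x y with h | h
  · left
    ext ⟨a, b⟩
    exact h₁.agree_of_agree h₂ ht₁ ht₂ hne (iff_of_true hxy h) a b
  · right
    ext ⟨a, b⟩
    exact h₁.agree_of_agree h₂.flip ht₁ (fun a b => ht₂ b a) hne (iff_of_true hxy h) a b
end

section
/- (Gerasimou) Let X be a connected topological space and R a non-trivial, transitive binary relation on X whose upper and lower sections are all closed. If R is not complete, then R is fragile: there exists (x,y) in the asymmetric part P of R such that every open neighborhood of (x,y) in X × X contains a pair (x',y') with (x',y') ∉ R ∪ R⁻¹. -/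
section Schmeidler

variable {X : Type*} [TopologicalSpace X] [ConnectedSpace X] {r : X → X → Prop}

/-- If the sections of `r` are closed and those of its asymmetric part are open, then for every
pair `(x, y)` in the asymmetric part, each `z` is strictly related to `y` or `x` to `z`. -/
theorem strict_or_strict_of_closed_of_open (htrans : ∀ x y z, r x y → r y z → r x z)
    (hupper : ∀ x, IsClosed {y | r x y}) (hlower : ∀ x, IsClosed {y | r y x})
    (hPupper : ∀ x, IsOpen {y | r x y ∧ ¬ r y x}) (hPlower : ∀ x, IsOpen {y | r y x ∧ ¬ r x y})
    {x y : X} (hxy : r x y) (hyx : ¬ r y x) (z : X) :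
    (r z y ∧ ¬ r y z) ∨ (r x z ∧ ¬ r z x) := by
  have heq : {z | r z y ∧ ¬ r y z} ∪ {z | r x z ∧ ¬ r z x} = {z | r z y} ∪ {z | r x z} := by
    ext w
    have h1 := htrans x y w hxy
    have h2 := htrans y w x
    have h3 := htrans w x y
    simp only [Set.mem_union, Set.mem_ofPred_eq]
    tauto
  have hclopen : IsClopen ({z | r z y ∧ ¬ r y z} ∪ {z | r x z ∧ ¬ r z x}) :=
    ⟨heq ▸ (hlower y).union (hupper x), (hPlower y).union (hPupper x)⟩
  have huniv := hclopen.eq_univ ⟨x, Or.inl ⟨hxy, hyx⟩⟩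
  exact huniv.ge (Set.mem_univ z)

/-- Two incomparable points are not both strictly related to a third one. -/
theorem not_common_strict_of_incomparable (htrans : ∀ x y z, r x y → r y z → r x z)
    (hupper : ∀ x, IsClosed {y | r x y}) (hPupper : ∀ x, IsOpen {y | r x y ∧ ¬ r y x})
    {u v y : X} (huv : ¬ r u v) (hvu : ¬ r v u)
    (hu : r u y ∧ ¬ r y u) (hv : r v y ∧ ¬ r y v) : False := by
  have heq : {z | r u z ∧ ¬ r z u} ∩ {z | r v z ∧ ¬ r z v} = {z | r u z} ∩ {z | r v z} := by
    ext w
    have h1 := htrans u w v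
    have h2 := htrans v w u
    simp only [Set.mem_inter_iff, Set.mem_ofPred_eq]
    tauto
  have hclopen : IsClopen ({z | r u z ∧ ¬ r z u} ∩ {z | r v z ∧ ¬ r z v}) :=
    ⟨heq ▸ (hupper u).inter (hupper v), (hPupper u).inter (hPupper v)⟩
  have huniv := hclopen.eq_univ ⟨y, hu, hv⟩
  have hmem : u ∈ {z | r u z ∧ ¬ r z u} ∩ {z | r v z ∧ ¬ r z v} := huniv.ge (Set.mem_univ u)
  exact hmem.1.2 hmem.1.1

/-- Schmeidler's theorem, without assuming reflexivity. -/
theorem complete_of_closed_of_open (htrans : ∀ x y z, r x y → r y z → r x z)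
    (hupper : ∀ x, IsClosed {y | r x y}) (hlower : ∀ x, IsClosed {y | r y x})
    (hPupper : ∀ x, IsOpen {y | r x y ∧ ¬ r y x}) (hPlower : ∀ x, IsOpen {y | r y x ∧ ¬ r x y})
    {x y : X} (hxy : r x y) (hyx : ¬ r y x) (u v : X) : r u v ∨ r v u := by
  by_contra! h
  have key := @strict_or_strict_of_closed_of_open _ _ _ _ htrans hupper hlower hPupper hPlower
  rcases key hxy hyx u with hu | hu
  · rcases key hu.1 hu.2 v with hv | hv
    · exact not_common_strict_of_incomparable htrans hupper hPupper h.1 h.2 hu hv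
    · exact h.1 hv.1
  · rcases key hu.1 hu.2 v with hv | hv
    · exact h.2 hv.1
    · exact not_common_strict_of_incomparable (r := fun a b => r b a)
        (fun a b c hab hbc => htrans c b a hbc hab) hlower hPlower h.2 h.1 hu hv

end Schmeidler


/-- Gerasimou's theorem: on a connected topological space, every incomplete,
non-trivial, transitive binary relation with closed upper and lower sections is
fragile: some strictly comparable pair (x,y) has non-comparable pairs in every open
neighborhood of (x,y) in X × X. -/
theorem gerasimou_fragile
    {X : Type*} [TopologicalSpace X] [ConnectedSpace X] (R : Set (X × X))
    -- non-triviality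
    (hNT : ∃ x y : X, (x, y) ∈ R ∧ (y, x) ∉ R)
    -- transitivity
    (hTrans : ∀ x y z : X, (x, y) ∈ R → (y, z) ∈ R → (x, z) ∈ R)
    -- upper and lower sections of R are closed
    (hRupper : ∀ x : X, IsClosed {y | (x, y) ∈ R})
    (hRlower : ∀ x : X, IsClosed {y | (y, x) ∈ R})
    -- R is not complete
    (hinc : ¬(∀ x y : X, (x, y) ∈ R ∨ (y, x) ∈ R)) :
    -- R is fragile
    ∃ x y : X, ((x, y) ∈ R ∧ (y, x) ∉ R) ∧
      ∀ U : Set (X × X), IsOpen U → (x, y) ∈ U →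
        ∃ p ∈ U, p ∉ R ∧ (p.2, p.1) ∉ R := by
  by_contra! hfrag
  have hPupper : ∀ x, IsOpen {y | (x, y) ∈ R ∧ (y, x) ∉ R} := by
    intro x
    refine isOpen_iff_mem_nhds.2 fun y hy => ?_
    obtain ⟨U, hU, hxyU, hcomp⟩ := hfrag x y hy
    have hsec : IsOpen {y' | (x, y') ∈ U} := hU.preimage (by fun_prop)
    filter_upwards [hsec.mem_nhds hxyU, (hRlower x).isOpen_compl.mem_nhds hy.2] with z hz hzx
    exact ⟨by_contra fun hxz => hzx (hcomp (x, z) hz hxz), hzx⟩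
  have hPlower : ∀ y, IsOpen {x | (x, y) ∈ R ∧ (y, x) ∉ R} := by
    intro y
    refine isOpen_iff_mem_nhds.2 fun x hx => ?_
    obtain ⟨U, hU, hxyU, hcomp⟩ := hfrag x y hx
    have hsec : IsOpen {x' | (x', y) ∈ U} := hU.preimage (by fun_prop)
    filter_upwards [hsec.mem_nhds hxyU, (hRupper y).isOpen_compl.mem_nhds hx.2] with z hz hyz
    exact ⟨by_contra fun hzy => hyz (hcomp (z, y) hz hzy), hyz⟩
  obtain ⟨x, y, hxy, hyx⟩ := hNT
  exact hinc fun u v => complete_of_closed_of_open (r := fun a b => (a, b) ∈ R)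
    hTrans hRupper hRlower hPupper hPlower hxy hyx u v
end

section
/- Let X be a connected topological space and R a non-trivial, transitive binary relation on X whose asymmetric part P has open upper and lower sections. If R is not complete, then R is flimsy: there exists (x,y) with (x,y) ∉ R ∪ R⁻¹ such that every open neighborhood of (x,y) in X × X contains a pair (x',y') ∈ R ∪ R⁻¹. -/
/-- **Schmeidler's theorem**: on a connected space, a non-trivial transitive relation with closed
sections whose asymmetric part has open sections is complete. -/
theorem complete_of_isClosed_sections_of_isOpen_asymm
    {X : Type*} [TopologicalSpace X] [ConnectedSpace X] {R : Set (X × X)}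
    (hNT : ∃ x y : X, (x, y) ∈ R ∧ (y, x) ∉ R)
    (hTrans : ∀ x y z : X, (x, y) ∈ R → (y, z) ∈ R → (x, z) ∈ R)
    (hPupper : ∀ x : X, IsOpen {y | (x, y) ∈ R ∧ (y, x) ∉ R})
    (hPlower : ∀ x : X, IsOpen {y | (y, x) ∈ R ∧ (x, y) ∉ R})
    (hRupper : ∀ x : X, IsClosed {y | (x, y) ∈ R})
    (hRlower : ∀ x : X, IsClosed {y | (y, x) ∈ R}) (a b : X) :
    (a, b) ∈ R ∨ (b, a) ∈ R := by
  have key : ∀ x y : X, (x, y) ∈ R → (y, x) ∉ R →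
      ∀ z, ((x, z) ∈ R ∧ (z, x) ∉ R) ∨ ((z, y) ∈ R ∧ (y, z) ∉ R) := by
    intro x y hxy hyx z
    have heq : {z | (x, z) ∈ R ∧ (z, x) ∉ R} ∪ {z | (z, y) ∈ R ∧ (y, z) ∉ R} =
        {z | (x, z) ∈ R} ∪ {z | (z, y) ∈ R} := by
      ext z
      have h1 := hTrans z x y
      have h2 := hTrans y z x
      have h3 := hTrans x y z
      simp only [Set.mem_union, Set.mem_ofPred_eq]
      tauto
    have hclopen : IsClopen ({z | (x, z) ∈ R ∧ (z, x) ∉ R} ∪ {z | (z, y) ∈ R ∧ (y, z) ∉ R}) :=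
      ⟨heq ▸ (hRupper x).union (hRlower y), (hPupper x).union (hPlower y)⟩
    have huniv := hclopen.eq_univ ⟨y, Or.inl ⟨hxy, hyx⟩⟩
    exact Set.eq_univ_iff_forall.mp huniv z
  by_contra! hab
  obtain ⟨x, y, hxy, hyx⟩ := hNT
  rcases key x y hxy hyx a with ha | ha
  · have hb : (x, b) ∈ R ∧ (b, x) ∉ R := by
      have := key x a ha.1 ha.2 b
      tauto
    have heq : {z | (z, a) ∈ R ∧ (a, z) ∉ R} ∩ {z | (z, b) ∈ R ∧ (b, z) ∉ R} =
        {z | (z, a) ∈ R} ∩ {z | (z, b) ∈ R} := by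
      ext z
      have h1 := hTrans a z b
      have h2 := hTrans b z a
      simp only [Set.mem_inter_iff, Set.mem_ofPred_eq]
      tauto
    have hclopen : IsClopen ({z | (z, a) ∈ R ∧ (a, z) ∉ R} ∩ {z | (z, b) ∈ R ∧ (b, z) ∉ R}) :=
      ⟨heq ▸ (hRlower a).inter (hRlower b), (hPlower a).inter (hPlower b)⟩
    have huniv := hclopen.eq_univ ⟨x, ha, hb⟩
    have hmem := Set.eq_univ_iff_forall.mp huniv a
    exact hmem.1.2 hmem.1.1
  · have hb : (b, y) ∈ R ∧ (y, b) ∉ R := by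
      have := key a y ha.1 ha.2 b
      tauto
    have heq : {z | (a, z) ∈ R ∧ (z, a) ∉ R} ∩ {z | (b, z) ∈ R ∧ (z, b) ∉ R} =
        {z | (a, z) ∈ R} ∩ {z | (b, z) ∈ R} := by
      ext z
      have h1 := hTrans a z b
      have h2 := hTrans b z a
      simp only [Set.mem_inter_iff, Set.mem_ofPred_eq]
      tauto
    have hclopen : IsClopen ({z | (a, z) ∈ R ∧ (z, a) ∉ R} ∩ {z | (b, z) ∈ R ∧ (z, b) ∉ R}) :=
      ⟨heq ▸ (hRupper a).inter (hRupper b), (hPupper a).inter (hPupper b)⟩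
    have huniv := hclopen.eq_univ ⟨y, ha, hb⟩
    have hmem := Set.eq_univ_iff_forall.mp huniv a
    exact hmem.1.2 hmem.1.1

/-- On a connected topological space, every incomplete, non-trivial, transitive binary
relation whose asymmetric part has open upper and lower sections is flimsy: some
non-comparable pair (x,y) has comparable pairs in every open neighborhood of (x,y)
in X × X. -/
theorem incomplete_flimsy
    {X : Type*} [TopologicalSpace X] [ConnectedSpace X] (R : Set (X × X))
    -- non-triviality
    (hNT : ∃ x y : X, (x, y) ∈ R ∧ (y, x) ∉ R)
    -- transitivity
    (hTrans : ∀ x y z : X, (x, y) ∈ R → (y, z) ∈ R → (x, z) ∈ R)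
    -- the asymmetric part P has open upper and lower sections
    (hPupper : ∀ x : X, IsOpen {y | (x, y) ∈ R ∧ (y, x) ∉ R})
    (hPlower : ∀ x : X, IsOpen {y | (y, x) ∈ R ∧ (x, y) ∉ R})
    -- R is not complete
    (hinc : ¬(∀ x y : X, (x, y) ∈ R ∨ (y, x) ∈ R)) :
    -- R is flimsy
    ∃ x y : X, ((x, y) ∉ R ∧ (y, x) ∉ R) ∧
      ∀ U : Set (X × X), IsOpen U → (x, y) ∈ U →
        ∃ p ∈ U, p ∈ R ∨ (p.2, p.1) ∈ R := by
  by_contra! hflimsy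
  refine hinc (complete_of_isClosed_sections_of_isOpen_asymm hNT hTrans hPupper hPlower ?_ ?_)
  · intro x
    rw [← isOpen_compl_iff, isOpen_iff_forall_mem_open]
    intro z (hz : (x, z) ∉ R)
    by_cases hzx : (z, x) ∈ R
    · exact ⟨_, fun w hw => hw.2, hPlower x, hzx, hz⟩
    · obtain ⟨U, hU, hmem, hdisj⟩ := hflimsy x z ⟨hz, hzx⟩
      exact ⟨(fun w => (x, w)) ⁻¹' U, fun w hw => (hdisj _ hw).1,
        hU.preimage (by fun_prop), hmem⟩
  · intro x
    rw [← isOpen_compl_iff, isOpen_iff_forall_mem_open]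
    intro z (hz : (z, x) ∉ R)
    by_cases hxz : (x, z) ∈ R
    · exact ⟨_, fun w hw => hw.2, hPupper x, hxz, hz⟩
    · obtain ⟨U, hU, hmem, hdisj⟩ := hflimsy z x ⟨hz, hxz⟩
      exact ⟨(fun w => (w, x)) ⁻¹' U, fun w hw => (hdisj _ hw).1,
        hU.preimage (by fun_prop), hmem⟩
end
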